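/- A connected graph G is a C-homogeneous bipartite graph if and only if G is isomorphic to one of the following: a semi-regular tree T_{κ,λ} for cardinals κ,λ; a cycle C_{2m} for some integer m ≥ 2; a complete bipartite graph K_{κ,λ} for cardinals κ,λ; the complement of a perfect matching CP_κ for a cardinal κ; or a homogeneous generic bipartite graph. -/

import Mathlib

open Set

universe u

/-- The underlying undirected graph of a digraph given by its edge relation. -/
def UG {V : Type u} (E : V → V → Prop) : SimpleGraph V := SimpleGraph.fromRel E

/-- `E` is a digraph edge relation: irreflexive and antisymmetric. -/
def IsDigraph {V : Type u} (E : V → V → Prop) : Prop :=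
  (∀ x, ¬ E x x) ∧ ∀ x y, E x y → ¬ E y x

/-- A ray in a graph: a one-way infinite path. -/
def IsRay {V : Type u} (G : SimpleGraph V) (r : ℕ → V) : Prop :=
  Function.Injective r ∧ ∀ n, G.Adj (r n) (r (n + 1))

/-- A sequence is eventually in a set. -/
def EventuallyIn {V : Type u} (r : ℕ → V) (C : Set V) : Prop :=
  ∃ N, ∀ n, N ≤ n → r n ∈ C

/-- `C` is a connected component of the subgraph of `G` induced on `W`:
a maximal connected subset of `W`. -/
def IsCompOf {V : Type u} (G : SimpleGraph V) (C W : Set V) : Prop :=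
  C.Nonempty ∧ C ⊆ W ∧ (G.induce C).Connected ∧
    ∀ C', C ⊆ C' → C' ⊆ W → (G.induce C').Connected → C' = C

/-- Two rays are equivalent if for every finite vertex set `S` they lie eventually
in the same component of the graph minus `S`. -/
def RayEquiv {V : Type u} (G : SimpleGraph V) (r r' : ℕ → V) : Prop :=
  ∀ S : Finset V, ∃ C : Set V, IsCompOf G C {v | v ∉ S} ∧
    EventuallyIn r C ∧ EventuallyIn r' C

/-- The graph has more than one end: two inequivalent rays. -/
def MoreThanOneEnd {V : Type u} (G : SimpleGraph V) : Prop :=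
  ∃ r r' : ℕ → V, IsRay G r ∧ IsRay G r' ∧ ¬ RayEquiv G r r'

/-- The graph has infinitely many ends: arbitrarily large families of pairwise
inequivalent rays. -/
def InfinitelyManyEnds {V : Type u} (G : SimpleGraph V) : Prop :=
  ∀ n : ℕ, ∃ f : Fin n → (ℕ → V), (∀ i, IsRay G (f i)) ∧
    ∀ i j, i ≠ j → ¬ RayEquiv G (f i) (f j)

/-- A separation of a graph: a pair of vertex sets covering `V` such that every
edge lies within one side. -/
def IsSeparation {V : Type u} (G : SimpleGraph V) (c : Set V × Set V) : Prop :=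
  c.1 ∪ c.2 = univ ∧ ∀ x y, G.Adj x y → (x ∈ c.1 ∧ y ∈ c.1) ∨ (x ∈ c.2 ∧ y ∈ c.2)

/-- The order of a separation: the number of vertices in its separator. -/
noncomputable def sepOrder {V : Type u} (c : Set V × Set V) : ℕ := (c.1 ∩ c.2).ncard

/-- The neighbourhood of a vertex set. -/
def Nbhd {V : Type u} (G : SimpleGraph V) (A : Set V) : Set V :=
  {v | v ∉ A ∧ ∃ u ∈ A, G.Adj u v}

/-- The separation `(A, ∼)`. -/
def tildeSep {V : Type u} (G : SimpleGraph V) (A : Set V) : Set V × Set V :=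
  (A, Aᶜ ∪ Nbhd G Aᶜ)

/-- `S` separates the wings of the separation `c`: every walk from one wing to
the other meets `S`. -/
def SeparatesWings {V : Type u} (G : SimpleGraph V) (c : Set V × Set V) (S : Set V) : Prop :=
  ∀ a ∈ c.1 \ c.2, ∀ b ∈ c.2 \ c.1, ∀ w : G.Walk a b, ∃ v ∈ w.support, v ∈ S

/-- A separation of finite order with non-empty wings is essential if its first wing is
connected and no proper subset of the separator separates the wings. -/
def IsEssential {V : Type u} (G : SimpleGraph V) (c : Set V × Set V) : Prop :=
  IsSeparation G c ∧ (c.1 ∩ c.2).Finite ∧ (c.1 \ c.2).Nonempty ∧ (c.2 \ c.1).Nonempty ∧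
  (G.induce (c.1 \ c.2)).Connected ∧
  ∀ S, S ⊂ c.1 ∩ c.2 → ¬ SeparatesWings G c S

/-- `C` is a wing of some separation in `𝒞`. -/
def IsWingOf {V : Type u} (𝒞 : Set (Set V × Set V)) (C : Set V) : Prop :=
  ∃ d ∈ 𝒞, C = d.1 \ d.2 ∨ C = d.2 \ d.1

/-- A cut system. -/
def IsCutSystem {V : Type u} (G : SimpleGraph V) (𝒞 : Set (Set V × Set V)) : Prop :=
  𝒞.Nonempty ∧ (∀ c ∈ 𝒞, IsEssential G c) ∧
  (∀ c ∈ 𝒞, ∃ d ∈ 𝒞, d.1 ⊆ c.2) ∧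
  (∀ c ∈ 𝒞, ∀ C : Set V, IsCompOf G C (c.2 \ c.1) →
    (∃ d ∈ 𝒞, d.1 \ d.2 ⊆ C) → tildeSep G (C ∪ Nbhd G C) ∈ 𝒞) ∧
  (∀ c ∈ 𝒞, ∀ c' ∈ 𝒞, ∃ C₁ C₂ : Set V,
    ((IsCompOf G C₁ ((c.1 \ c.2) ∩ (c'.1 \ c'.2)) ∧
      IsCompOf G C₂ ((c.2 \ c.1) ∩ (c'.2 \ c'.1))) ∨
     (IsCompOf G C₁ ((c.2 \ c.1) ∩ (c'.1 \ c'.2)) ∧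
      IsCompOf G C₂ ((c.1 \ c.2) ∩ (c'.2 \ c'.1)))) ∧
    IsWingOf 𝒞 C₁ ∧ IsWingOf 𝒞 C₂)

/-- Pick a side of a separation. -/
def pickSide {V : Type u} (c : Set V × Set V) : Bool → Set V
  | false => c.1
  | true => c.2

/-- Two cuts are nested (with respect to the cut system `𝒞`). -/
def NestedPair {V : Type u} (G : SimpleGraph V) (𝒞 : Set (Set V × Set V))
    (c d : Set V × Set V) : Prop :=
  ∃ i j : Bool,
    ((¬ ∃ C, IsCompOf G C ((tildeSep G (pickSide c i ∩ pickSide d j)).1 \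
        (tildeSep G (pickSide c i ∩ pickSide d j)).2) ∧
        tildeSep G (C ∪ Nbhd G C) ∈ 𝒞) ∨
     (¬ ∃ C, IsCompOf G C ((tildeSep G (pickSide c i ∩ pickSide d j)).2 \
        (tildeSep G (pickSide c i ∩ pickSide d j)).1) ∧
        tildeSep G (C ∪ Nbhd G C) ∈ 𝒞)) ∧
    (c.1 ∩ c.2) ∪ (d.1 ∩ d.2) ⊆ pickSide c (!i) ∩ pickSide d (!j)

/-- A cut system is nested if each two of its cuts are nested. -/
def IsNestedSystem {V : Type u} (G : SimpleGraph V) (𝒞 : Set (Set V × Set V)) : Prop :=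
  ∀ c ∈ 𝒞, ∀ d ∈ 𝒞, NestedPair G 𝒞 c d

/-- `S` is a `𝒞`-separator. -/
def IsSeparatorOf {V : Type u} (𝒞 : Set (Set V × Set V)) (S : Set V) : Prop :=
  ∃ c ∈ 𝒞, c.1 ∩ c.2 = S

/-- A vertex set contains an end: some ray lies in it. -/
def ContainsEnd {V : Type u} (G : SimpleGraph V) (A : Set V) : Prop :=
  ∃ r : ℕ → V, IsRay G r ∧ ∀ n, r n ∈ A

/-- A basic cut system. -/
def IsBasic {V : Type u} (G : SimpleGraph V) (𝒞 : Set (Set V × Set V)) : Prop :=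
  IsCutSystem G 𝒞 ∧
  (∀ c ∈ 𝒞, ∀ d ∈ 𝒞, ¬ sepOrder c < sepOrder d) ∧
  IsNestedSystem G 𝒞 ∧
  (∀ φ : G ≃g G, ∀ c ∈ 𝒞, ((⇑φ '' c.1, ⇑φ '' c.2) : Set V × Set V) ∈ 𝒞) ∧
  (∀ S S' : Set V, IsSeparatorOf 𝒞 S → IsSeparatorOf 𝒞 S' → ∃ φ : G ≃g G, ⇑φ '' S = S') ∧
  (∀ c ∈ 𝒞, ContainsEnd G c.1 ∧ ContainsEnd G c.2 ∧
    ¬ ∃ d : Set V × Set V, IsSeparation G d ∧ (d.1 ∩ d.2).Finite ∧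
      (d.1 ∩ d.2).ncard < sepOrder c ∧ ContainsEnd G d.1 ∧ ContainsEnd G d.2)

/-- The defining property of a `𝒞`-block. -/
def BlockProp {V : Type u} (𝒞 : Set (Set V × Set V)) (X : Set V) : Prop :=
  (∀ c ∈ 𝒞, (X ⊆ c.1 ∨ X ⊆ c.2) ∧ ¬ (X ⊆ c.1 ∧ X ⊆ c.2)) ∧
  ∃ c ∈ 𝒞, X ⊆ c.1 ∧ c.1 ∩ c.2 ⊆ X

/-- A `𝒞`-block: a maximal vertex set with the block property. -/
def IsCBlock {V : Type u} (𝒞 : Set (Set V × Set V)) (X : Set V) : Prop :=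
  BlockProp 𝒞 X ∧ ∀ X', X ⊆ X' → BlockProp 𝒞 X' → X' = X

/-- A digraph is C-homogeneous: every isomorphism between finite induced
subdigraphs with connected underlying graphs extends to an automorphism. -/
def DigraphCHom {V : Type u} (E : V → V → Prop) : Prop :=
  ∀ (X Y : Set V), X.Finite → Y.Finite → ((UG E).induce X).Connected →
  ∀ φ : X ≃ Y, (∀ a b : X, E a.1 b.1 ↔ E (φ a).1 (φ b).1) →
  ∃ ψ : Equiv.Perm V, (∀ x y, E (ψ x) (ψ y) ↔ E x y) ∧ ∀ a : X, ψ a.1 = (φ a).1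

/-- A graph is C-homogeneous: every isomorphism between finite connected induced
subgraphs extends to an automorphism. -/
def GraphCHom {V : Type u} (G : SimpleGraph V) : Prop :=
  ∀ (X Y : Set V), X.Finite → Y.Finite → (G.induce X).Connected →
  ∀ φ : X ≃ Y, (∀ a b : X, G.Adj a.1 b.1 ↔ G.Adj (φ a).1 (φ b).1) →
  ∃ ψ : G ≃g G, ∀ a : X, ψ a.1 = (φ a).1

/-- The digraph contains a triangle: three pairwise adjacent vertices. -/
def HasTriangle {V : Type u} (E : V → V → Prop) : Prop :=
  ∃ x y z : V, (UG E).Adj x y ∧ (UG E).Adj y z ∧ (UG E).Adj x z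

/-- An `n`-arc: a directed path `p 0, p 1, …, p n`. -/
def IsArc {V : Type u} (E : V → V → Prop) (n : ℕ) (p : ℕ → V) : Prop :=
  (∀ i j, i ≤ n → j ≤ n → p i = p j → i = j) ∧ ∀ i < n, E (p i) (p (i + 1))

/-- A digraph is highly-arc-transitive: for every `n`, its automorphism group acts
transitively on `n`-arcs. -/
def HighlyArcTransitive {V : Type u} (E : V → V → Prop) : Prop :=
  ∀ n : ℕ, ∀ p q : ℕ → V, IsArc E n p → IsArc E n q →
  ∃ ψ : Equiv.Perm V, (∀ x y, E (ψ x) (ψ y) ↔ E x y) ∧ ∀ i ≤ n, ψ (p i) = q i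

/-- An alternating walk `w 0, …, w n` in a digraph. -/
def IsAltWalk {V : Type u} (E : V → V → Prop) (n : ℕ) (w : ℕ → V) : Prop :=
  (∀ i < n, E (w i) (w (i + 1)) ∨ E (w (i + 1)) (w i)) ∧
  ∀ i, i + 2 ≤ n → (E (w i) (w (i + 1)) ↔ E (w (i + 2)) (w (i + 1)))

/-- The edge `e` lies on the walk `w 0, …, w n` (in either direction). -/
def EdgeOnWalk {V : Type u} (n : ℕ) (w : ℕ → V) (e : V × V) : Prop :=
  ∃ i < n, (w i = e.1 ∧ w (i + 1) = e.2) ∨ (w i = e.2 ∧ w (i + 1) = e.1)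

/-- Two edges are reachable from each other: they lie on a common alternating walk. -/
def Reach {V : Type u} (E : V → V → Prop) (e f : V × V) : Prop :=
  ∃ n w, IsAltWalk E n w ∧ EdgeOnWalk n w e ∧ EdgeOnWalk n w f

/-- The edge relation of the reachability digraph `Δ_e`. -/
def DeltaRel {V : Type u} (E : V → V → Prop) (e : V × V) : V → V → Prop :=
  fun x y => E x y ∧ Reach E e (x, y)

/-- The underlying undirected graph of the reachability digraph `Δ_e`. -/
def DeltaGraph {V : Type u} (E : V → V → Prop) (e : V × V) : SimpleGraph V :=
  UG (DeltaRel E e)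

/-- Tails of edges of `𝒜(e)`. -/
def Tails {V : Type u} (E : V → V → Prop) (e : V × V) : Set V :=
  {x | ∃ y, DeltaRel E e x y}

/-- Heads of edges of `𝒜(e)`. -/
def Heads {V : Type u} (E : V → V → Prop) (e : V × V) : Set V :=
  {y | ∃ x, DeltaRel E e x y}

/-- The set of descendants of a vertex. -/
def Descendants {V : Type u} (E : V → V → Prop) (x : V) : Set V :=
  {y | ∃ n p, IsArc E n p ∧ p 0 = x ∧ p n = y}

/-- `(X, Y)` is a bipartition of the graph `G`. -/
def IsBipartition {V : Type u} (G : SimpleGraph V) (X Y : Set V) : Prop :=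
  X ∪ Y = univ ∧ Disjoint X Y ∧
  ∀ a b, G.Adj a b → (a ∈ X ∧ b ∈ Y) ∨ (a ∈ Y ∧ b ∈ X)

/-- `G` with sides `X`, `Y` is C-homogeneous bipartite: every isomorphism between
finite connected induced subgraphs preserving the sides extends to a side-preserving
automorphism. -/
def BipCHom {V : Type u} (G : SimpleGraph V) (X Y : Set V) : Prop :=
  ∀ (A B : Set V), A.Finite → B.Finite → (G.induce A).Connected →
  ∀ φ : A ≃ B, (∀ a b : A, G.Adj a.1 b.1 ↔ G.Adj (φ a).1 (φ b).1) →
  (∀ a : A, a.1 ∈ X ↔ (φ a).1 ∈ X) → (∀ a : A, a.1 ∈ Y ↔ (φ a).1 ∈ Y) →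
  ∃ ψ : G ≃g G, (∀ v, v ∈ X ↔ ψ v ∈ X) ∧ (∀ v, v ∈ Y ↔ ψ v ∈ Y) ∧
    ∀ a : A, ψ a.1 = (φ a).1

/-- `G` with sides `X`, `Y` is homogeneous bipartite: every isomorphism between
finite induced subgraphs preserving the sides extends to a side-preserving
automorphism. -/
def BipHom {V : Type u} (G : SimpleGraph V) (X Y : Set V) : Prop :=
  ∀ (A B : Set V), A.Finite → B.Finite →
  ∀ φ : A ≃ B, (∀ a b : A, G.Adj a.1 b.1 ↔ G.Adj (φ a).1 (φ b).1) →
  (∀ a : A, a.1 ∈ X ↔ (φ a).1 ∈ X) → (∀ a : A, a.1 ∈ Y ↔ (φ a).1 ∈ Y) →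
  ∃ ψ : G ≃g G, (∀ v, v ∈ X ↔ ψ v ∈ X) ∧ (∀ v, v ∈ Y ↔ ψ v ∈ Y) ∧
    ∀ a : A, ψ a.1 = (φ a).1

/-- `G` with sides `X`, `Y` is generic bipartite. -/
def GenericBip {V : Type u} (G : SimpleGraph V) (X Y : Set V) : Prop :=
  (∀ U W : Set V, U ⊆ X → W ⊆ X → U.Finite → W.Finite → Disjoint U W →
    ∃ v ∈ Y, (∀ u ∈ U, G.Adj v u) ∧ ∀ w ∈ W, ¬ G.Adj v w) ∧
  (∀ U W : Set V, U ⊆ Y → W ⊆ Y → U.Finite → W.Finite → Disjoint U W →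
    ∃ v ∈ X, (∀ u ∈ U, G.Adj v u) ∧ ∀ w ∈ W, ¬ G.Adj v w)

/-- `G` is a semi-regular tree `T_{κ,λ}`: a tree whose two bipartition classes
each have constant degree. -/
def IsSemiregularTree {V : Type u} (G : SimpleGraph V) : Prop :=
  G.IsTree ∧ ∃ X Y : Set V, IsBipartition G X Y ∧
    (∀ a ∈ X, ∀ a' ∈ X, Nonempty (G.neighborSet a ≃ G.neighborSet a')) ∧
    (∀ b ∈ Y, ∀ b' ∈ Y, Nonempty (G.neighborSet b ≃ G.neighborSet b'))

/-- `G` is a cycle `C_{2m}` for some integer `m ≥ 2`. -/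
def IsEvenCycle {V : Type u} (G : SimpleGraph V) : Prop :=
  ∃ m : ℕ, 2 ≤ m ∧ Nonempty (G ≃g SimpleGraph.cycleGraph (2 * m))

/-- `G` is a complete bipartite graph `K_{κ,λ}`. -/
def IsCompleteBip {V : Type u} (G : SimpleGraph V) : Prop :=
  ∃ X Y : Set V, IsBipartition G X Y ∧ ∀ a ∈ X, ∀ b ∈ Y, G.Adj a b

/-- `G` is the complement of a perfect matching `CP_κ`: it arises from a complete
bipartite graph with equinumerous sides by deleting a perfect matching. -/
def IsCPGraph {V : Type u} (G : SimpleGraph V) : Prop :=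
  ∃ X Y : Set V, IsBipartition G X Y ∧
    ∃ f : X ≃ Y, ∀ (a : X) (b : Y), G.Adj a.1 b.1 ↔ b.1 ≠ (f a).1

/-- `G` is a homogeneous generic bipartite graph. -/
def IsHomGenericBip {V : Type u} (G : SimpleGraph V) : Prop :=
  ∃ X Y : Set V, IsBipartition G X Y ∧ GenericBip G X Y ∧ BipHom G X Y

section
variable {V : Type u} {G : SimpleGraph V} {X Y : Set V}

lemma IsBipartition.symm (hb : IsBipartition G X Y) : IsBipartition G Y X :=
  ⟨by rw [union_comm]; exact hb.1, hb.2.1.symm, fun a b h => (hb.2.2 a b h).symm⟩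

lemma IsBipartition.mem_right_iff (hb : IsBipartition G X Y) {v : V} : v ∈ Y ↔ v ∉ X := by
  constructor
  · exact fun h h' => Set.disjoint_left.1 hb.2.1 h' h
  · intro h
    have : v ∈ X ∪ Y := hb.1 ▸ mem_univ v
    exact this.resolve_left h

lemma IsBipartition.mem_left_iff (hb : IsBipartition G X Y) {v : V} : v ∈ X ↔ v ∉ Y :=
  hb.symm.mem_right_iff

lemma IsBipartition.mem_left_or_right (hb : IsBipartition G X Y) (v : V) : v ∈ X ∨ v ∈ Y := by
  rw [hb.mem_right_iff]
  exact em _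

lemma IsBipartition.not_mem_of_adj (hb : IsBipartition G X Y) {a b : V} (h : G.Adj a b) :
    a ∈ X ↔ b ∉ X := by
  have h1 := hb.2.2 a b h
  rw [hb.mem_right_iff, hb.mem_right_iff] at h1
  tauto

lemma IsBipartition.mem_right_of_adj (hb : IsBipartition G X Y) {a b : V} (h : G.Adj a b)
    (ha : a ∈ X) : b ∈ Y :=
  hb.mem_right_iff.2 ((hb.not_mem_of_adj h).1 ha)

lemma IsBipartition.mem_left_of_adj (hb : IsBipartition G X Y) {a b : V} (h : G.Adj a b)
    (ha : a ∈ Y) : b ∈ X :=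
  hb.symm.mem_right_of_adj h ha

lemma IsBipartition.not_adj_left (hb : IsBipartition G X Y) {a b : V} (ha : a ∈ X) (hb' : b ∈ X) :
    ¬ G.Adj a b := fun h => (hb.not_mem_of_adj h).1 ha hb'

lemma IsBipartition.not_adj_right (hb : IsBipartition G X Y) {a b : V} (ha : a ∈ Y)
    (hb' : b ∈ Y) : ¬ G.Adj a b := hb.symm.not_adj_left ha hb'

/-- An automorphism that maps each side of a bipartition to itself. -/
def PreservesSides (X Y : Set V) (ψ : G ≃g G) : Prop :=
  (∀ v, v ∈ X ↔ ψ v ∈ X) ∧ ∀ v, v ∈ Y ↔ ψ v ∈ Y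

lemma PreservesSides.swap {ψ : G ≃g G} (h : PreservesSides X Y ψ) : PreservesSides Y X ψ :=
  ⟨h.2, h.1⟩

lemma BipCHom.symm (hc : BipCHom G X Y) : BipCHom G Y X := by
  intro A B hA hB hAc φ h1 h2 h3
  obtain ⟨ψ, h4, h5, h6⟩ := hc A B hA hB hAc φ h1 h3 h2
  exact ⟨ψ, h5, h4, h6⟩

/-- C-homogeneity for indexed families: an indexed family whose members are all linked to one
of them can be moved to any family with the same adjacencies and sides. -/
lemma BipCHom.exists_aut {ι : Type*} [Finite ι] (hb : IsBipartition G X Y) (hc : BipCHom G X Y)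
    (a b : ι → V) (heq : ∀ i j, a i = a j ↔ b i = b j)
    (hadj : ∀ i j, G.Adj (a i) (a j) ↔ G.Adj (b i) (b j)) (hX : ∀ i, a i ∈ X ↔ b i ∈ X)
    (i₀ : ι) (hconn : ∀ i, Relation.ReflTransGen (fun i j => G.Adj (a i) (a j)) i₀ i) :
    ∃ ψ : G ≃g G, PreservesSides X Y ψ ∧ ∀ i, ψ (a i) = b i := by
  classical
  have hs : ∀ z : range a, a (rangeSplitting a z) = z := apply_rangeSplitting a
  have hinj : Function.Injective
      (fun z : range a => (⟨b (rangeSplitting a z), mem_range_self _⟩ : range b)) := by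
    intro z w h
    have h' := (heq _ _).2 (congrArg Subtype.val h)
    rw [hs, hs] at h'
    exact Subtype.ext h'
  have hval : ∀ i, b (rangeSplitting a ⟨a i, mem_range_self i⟩) = b i := fun i =>
    (heq _ _).1 (hs _)
  have hsurj : Function.Surjective
      (fun z : range a => (⟨b (rangeSplitting a z), mem_range_self _⟩ : range b)) := by
    rintro ⟨_, i, rfl⟩
    exact ⟨⟨a i, mem_range_self i⟩, Subtype.ext (hval i)⟩
  have hcon : (G.induce (range a)).Connected := by
    rw [SimpleGraph.connected_iff_exists_forall_reachable]
    refine ⟨⟨a i₀, mem_range_self _⟩, ?_⟩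
    rintro ⟨_, i, rfl⟩
    induction hconn i with
    | refl => exact SimpleGraph.Reachable.refl _
    | tail _ h ih =>
      refine ih.trans (SimpleGraph.Adj.reachable ?_)
      simpa using h
  obtain ⟨φ, hφ⟩ : ∃ φ : range a ≃ range b, ∀ z, (φ z).1 = b (rangeSplitting a z) :=
    ⟨Equiv.ofBijective _ (And.intro hinj hsurj : Function.Bijective _), fun z => rfl⟩
  obtain ⟨ψ, h1, h2, h3⟩ := hc (range a) (range b) (finite_range a) (finite_range b) hcon φ
    (fun z w => by rw [hφ, hφ, ← hadj, hs, hs])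
    (fun z => by rw [hφ, ← hX, hs])
    (fun z => by rw [hφ, hb.mem_right_iff, hb.mem_right_iff, ← hX, hs])
  exact ⟨ψ, ⟨h1, h2⟩, fun i => (h3 ⟨a i, mem_range_self i⟩).trans ((hφ _).trans (hval i))⟩

lemma BipCHom.exists_aut_star {ι : Type*} [Finite ι] (hb : IsBipartition G X Y)
    (hc : BipCHom G X Y) {y y' : V} (hy : y ∈ Y) (hy' : y' ∈ Y) (a b : ι → V)
    (ha : Function.Injective a) (hb' : Function.Injective b)
    (hya : ∀ i, G.Adj y (a i)) (hyb : ∀ i, G.Adj y' (b i)) :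
    ∃ ψ : G ≃g G, PreservesSides X Y ψ ∧ ψ y = y' ∧ ∀ i, ψ (a i) = b i := by
  have haX : ∀ i, a i ∈ X := fun i => hb.mem_left_of_adj (hya i) hy
  have hbX : ∀ i, b i ∈ X := fun i => hb.mem_left_of_adj (hyb i) hy'
  obtain ⟨ψ, h1, h2⟩ := BipCHom.exists_aut (ι := Option ι) hb hc
    (fun o => o.elim y a) (fun o => o.elim y' b)
    (by
      rintro (_ | i) (_ | j)
      · simp
      · simp [(hya j).ne, (hyb j).ne]
      · simp [(hya i).ne', (hyb i).ne']
      · simp [ha.eq_iff, hb'.eq_iff])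
    (by
      rintro (_ | i) (_ | j)
      · simp
      · simp [hya, hyb]
      · simp [(hya i).symm, (hyb i).symm]
      · simp [hb.not_adj_left (haX i) (haX j), hb.not_adj_left (hbX i) (hbX j)])
    (by
      rintro (_ | i)
      · simp [hb.mem_left_iff, hy, hy']
      · simp [haX, hbX])
    none
    (by
      rintro (_ | i)
      · exact .refl
      · exact .single (by simpa using hya i))
  exact ⟨ψ, h1, h2 none, fun i => h2 (some i)⟩

lemma BipCHom.exists_aut_vertex (hb : IsBipartition G X Y)
    (hc : BipCHom G X Y) {y y' : V} (hy : y ∈ Y) (hy' : y' ∈ Y) :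
    ∃ ψ : G ≃g G, PreservesSides X Y ψ ∧ ψ y = y' := by
  obtain ⟨ψ, h1, h2, -⟩ := BipCHom.exists_aut_star (ι := Empty) hb hc hy hy' Empty.elim Empty.elim
    (fun i => i.elim) (fun i => i.elim) (fun i => i.elim) (fun i => i.elim)
  exact ⟨ψ, h1, h2⟩

/-- In a C-homogeneous bipartite graph one member of a finite linked set can be replaced by a
vertex with the same adjacencies to the other members. -/
lemma BipCHom.exists_aut_replace [DecidableEq V] (hb : IsBipartition G X Y) (hc : BipCHom G X Y)
    (A : Finset V) {p p' : V} (hp : p ∈ X) (hp' : p' ∈ X) (hp'A : p' ∉ A)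
    (hA : ∀ j ∈ A, j ≠ p → (G.Adj p j ↔ G.Adj p' j)) (o : A)
    (hconn : ∀ i : A, Relation.ReflTransGen (fun i j : A => G.Adj i.1 j.1) o i) :
    ∃ ψ : G ≃g G, PreservesSides X Y ψ ∧ (p ∈ A → ψ p = p') ∧ ∀ i ∈ A, i ≠ p → ψ i = i := by
  obtain ⟨ψ, h1, h2⟩ := hc.exists_aut hb (fun i : A => i.1) (fun i : A => if i.1 = p then p' else i.1)
    (by
      rintro ⟨i, hi⟩ ⟨j, hj⟩
      by_cases h1 : i = p <;> by_cases h2 : j = p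
      · simp [h1, h2]
      · have : p' ≠ j := fun h => hp'A (h ▸ hj)
        simp [h1, h2, this, Ne.symm h2]
      · have : i ≠ p' := fun h => hp'A (h ▸ hi)
        simp [h1, h2, this]
      · simp [h1, h2])
    (by
      rintro ⟨i, hi⟩ ⟨j, hj⟩
      by_cases h1 : i = p <;> by_cases h2 : j = p
      · simp [h1, h2]
      · simp [h1, h2, hA j hj h2]
      · simp [h1, h2, G.adj_comm i, hA i hi h1]
      · simp [h1, h2])
    (by
      rintro ⟨i, hi⟩
      by_cases h1 : i = p <;> simp [h1, hp, hp'])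
    o hconn
  refine ⟨ψ, h1, fun h => by simpa using h2 ⟨p, h⟩, fun i hi hip => by simpa [hip] using h2 ⟨i, hi⟩⟩

/-- A property that holds at one vertex and passes to neighbours holds at every vertex. -/
lemma SimpleGraph.Connected.forall_of_adj {G : SimpleGraph V} (hconn : G.Connected) {p : V → Prop}
    {v : V} (hv : p v) (h : ∀ a b, p a → G.Adj a b → p b) (w : V) : p w := by
  obtain ⟨q⟩ := hconn.preconnected v w
  induction q with
  | nil => exact hv
  | cons hadj _ ih => exact ih (h _ _ hv hadj)

/-- Every `n`-subset of `X` has a common neighbour in `Y`. -/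
def CommonNbrs (G : SimpleGraph V) (X Y : Set V) (n : ℕ) : Prop :=
  ∀ U : Finset V, ↑U ⊆ X → U.card = n → ∃ y ∈ Y, ∀ u ∈ U, G.Adj y u

/-- If any two neighbourhoods sharing `t + 2` vertices coincide, every `t + 2` vertices have a
common neighbour and some vertex has `t + 3` neighbours, then the graph is complete bipartite:
otherwise three further neighbourhoods through `t + 1` points can be met in a
`t + 3`-set with or without a common neighbour, and homogeneity cannot distinguish the two. -/
lemma adj_of_commonNbrs_of_steiner (hb : IsBipartition G X Y) (hc : BipCHom G X Y) {t : ℕ}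
    (hP : CommonNbrs G X Y (t + 2))
    (hS : ∀ y ∈ Y, ∀ y' ∈ Y, ∀ U : Finset V, U.card = t + 2 → (∀ u ∈ U, G.Adj y u) →
      (∀ u ∈ U, G.Adj y' u) → ∀ x, G.Adj y x → G.Adj y' x)
    (hbig : ∃ y ∈ Y, ∃ U : Finset V, U.card = t + 3 ∧ ∀ u ∈ U, G.Adj y u) :
    ∀ x ∈ X, ∀ y ∈ Y, G.Adj x y := by
  classical
  intro x hx l₁ hl₁
  by_contra hxl₁
  have hxl₁ : ¬ G.Adj l₁ x := fun h => hxl₁ h.symm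
  have hbig' : ∀ y ∈ Y, ∃ U : Finset V, U.card = t + 3 ∧ ∀ u ∈ U, G.Adj y u := by
    intro y hy
    obtain ⟨y', hy', U, hU, hU'⟩ := hbig
    obtain ⟨ψ, -, hψ⟩ := hc.exists_aut_vertex hb hy' hy
    refine ⟨U.map ψ.toEquiv.toEmbedding, by simpa using hU, ?_⟩
    intro u hu
    obtain ⟨v, hv, rfl⟩ := Finset.mem_map.1 hu
    exact hψ ▸ ψ.map_adj_iff.2 (hU' v hv)
  have hext : ∀ y ∈ Y, ∀ F : Finset V, F.card ≤ t + 2 → ∃ p, p ∉ F ∧ G.Adj y p := by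
    intro y hy F hF
    obtain ⟨U, hU, hU'⟩ := hbig' y hy
    obtain ⟨p, hp, hpF⟩ := Finset.exists_mem_notMem_of_card_lt_card (s := F) (t := U) (by omega)
    exact ⟨p, hpF, hU' p hp⟩
  obtain ⟨U, hU, hU'⟩ := hbig' l₁ hl₁
  obtain ⟨p₁, U₂, hp₁, rfl, hU₂⟩ := Finset.card_eq_succ.1 hU
  obtain ⟨o, U₃, ho, rfl, hU₃⟩ := Finset.card_eq_succ.1 hU₂
  obtain ⟨q, T, hq, rfl, hT⟩ := Finset.card_eq_succ.1 hU₃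
  simp only [Finset.mem_insert, not_or, forall_eq_or_imp] at hp₁ ho hU'
  obtain ⟨hp₁o, -, hp₁T⟩ := hp₁
  obtain ⟨-, hoT⟩ := ho
  obtain ⟨hl₁p₁, hl₁o, -, hl₁T⟩ := hU'
  have hp₁X : p₁ ∈ X := hb.mem_left_of_adj hl₁p₁ hl₁
  have hoX : o ∈ X := hb.mem_left_of_adj hl₁o hl₁
  have hTX : ∀ u ∈ T, u ∈ X := fun u hu => hb.mem_left_of_adj (hl₁T u hu) hl₁
  have hP' : ∀ a ∈ X, ∀ b ∈ X, a ≠ b → a ∉ T → b ∉ T →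
      ∃ m ∈ Y, G.Adj m a ∧ G.Adj m b ∧ ∀ u ∈ T, G.Adj m u := by
    intro a ha b hb' hab haT hbT
    obtain ⟨m, hm, hm'⟩ := hP (insert a (insert b T))
      (by
        intro z hz
        simp only [Finset.coe_insert, mem_insert_iff, Finset.mem_coe] at hz
        rcases hz with rfl | rfl | hz
        exacts [ha, hb', hTX z hz])
      (by rw [Finset.card_insert_of_notMem (by simp [hab, haT]),
            Finset.card_insert_of_notMem hbT, hT])
    simp only [Finset.mem_insert, forall_eq_or_imp] at hm'
    exact ⟨m, hm, hm'⟩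
  have hS' : ∀ y ∈ Y, ∀ y' ∈ Y, ∀ a b, a ≠ b → a ∉ T → b ∉ T → (∀ u ∈ T, G.Adj y u) →
      (∀ u ∈ T, G.Adj y' u) → G.Adj y a → G.Adj y b → G.Adj y' a → G.Adj y' b →
      ∀ z, G.Adj y z → G.Adj y' z := by
    intro y hy y' hy' a b hab haT hbT hyT hy'T h1 h2 h3 h4
    refine hS y hy y' hy' (insert a (insert b T)) ?_ ?_ ?_
    · rw [Finset.card_insert_of_notMem (by simp [hab, haT]), Finset.card_insert_of_notMem hbT, hT]
    · simpa only [Finset.mem_insert, forall_eq_or_imp] using ⟨h1, h2, hyT⟩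
    · simpa only [Finset.mem_insert, forall_eq_or_imp] using ⟨h3, h4, hy'T⟩
  have hxT : x ∉ T := fun h => hxl₁ (hl₁T x h)
  have hxo : o ≠ x := by rintro rfl; exact hxl₁ hl₁o
  have hxp₁ : p₁ ≠ x := by rintro rfl; exact hxl₁ hl₁p₁
  obtain ⟨l₂, hl₂, hl₂o, hl₂x, hl₂T⟩ := hP' o hoX x hx hxo hoT hxT
  have hl₂p₁ : ¬ G.Adj l₂ p₁ := fun h =>
    hxl₁ (hS' l₂ hl₂ l₁ hl₁ o p₁ (Ne.symm hp₁o) hoT hp₁T hl₂T hl₁T hl₂o h hl₁o hl₁p₁ x hl₂x)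
  obtain ⟨m, hm, hmp₁, hmx, hmT⟩ := hP' p₁ hp₁X x hx hxp₁ hp₁T hxT
  have hmo : ¬ G.Adj m o := fun h =>
    hxl₁ (hS' m hm l₁ hl₁ o p₁ (Ne.symm hp₁o) hoT hp₁T hmT hl₁T h hmp₁ hl₁o hl₁p₁ x hmx)
  obtain ⟨p₃, hp₃, hmp₃⟩ := hext m hm (insert p₁ (insert x T))
    (by rw [Finset.card_insert_of_notMem (by simp [hxp₁, hp₁T]),
          Finset.card_insert_of_notMem hxT, hT])
  simp only [Finset.mem_insert, not_or] at hp₃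
  obtain ⟨hp₃p₁, hp₃x, hp₃T⟩ := hp₃
  have hp₃X : p₃ ∈ X := hb.mem_left_of_adj hmp₃ hm
  have hp₃o : o ≠ p₃ := by rintro rfl; exact hmo hmp₃
  have hl₁p₃ : ¬ G.Adj l₁ p₃ := fun h =>
    hxl₁ (hS' m hm l₁ hl₁ p₃ p₁ hp₃p₁ hp₃T hp₁T hmT hl₁T hmp₃ hmp₁ h hl₁p₁ x hmx)
  have hl₂p₃ : ¬ G.Adj l₂ p₃ := fun h =>
    hmo (hS' l₂ hl₂ m hm p₃ x hp₃x hp₃T hxT hl₂T hmT h hl₂x hmp₃ hmx o hl₂o)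
  obtain ⟨l₃, hl₃, hl₃o, hl₃p₃, hl₃T⟩ := hP' o hoX p₃ hp₃X hp₃o hoT hp₃T
  have hl₃p₁ : ¬ G.Adj l₃ p₁ := fun h =>
    hl₁p₃ (hS' l₃ hl₃ l₁ hl₁ o p₁ (Ne.symm hp₁o) hoT hp₁T hl₃T hl₁T hl₃o h hl₁o hl₁p₁ p₃ hl₃p₃)
  have hl₃x : ¬ G.Adj l₃ x := fun h =>
    hl₂p₃ (hS' l₃ hl₃ l₂ hl₂ o x hxo hoT hxT hl₃T hl₂T hl₃o h hl₂o hl₂x p₃ hl₃p₃)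
  obtain ⟨p', hp', hl₃p'⟩ := hext l₃ hl₃ (insert o (insert p₃ T))
    (by rw [Finset.card_insert_of_notMem (by simp [hp₃o, hoT]),
          Finset.card_insert_of_notMem hp₃T, hT])
  simp only [Finset.mem_insert, not_or] at hp'
  obtain ⟨hp'o, hp'p₃, hp'T⟩ := hp'
  have hp'X : p' ∈ X := hb.mem_left_of_adj hl₃p' hl₃
  have hl₁p' : ¬ G.Adj l₁ p' := fun h =>
    hl₁p₃ (hS' l₃ hl₃ l₁ hl₁ p' o hp'o hp'T hoT hl₃T hl₁T hl₃p' hl₃o h hl₁o p₃ hl₃p₃)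
  have hl₂p' : ¬ G.Adj l₂ p' := fun h =>
    hl₂p₃ (hS' l₃ hl₃ l₂ hl₂ p' o hp'o hp'T hoT hl₃T hl₂T hl₃p' hl₃o h hl₂o p₃ hl₃p₃)
  have hmp' : ¬ G.Adj m p' := fun h =>
    hmo (hS' l₃ hl₃ m hm p' p₃ hp'p₃ hp'T hp₃T hl₃T hmT hl₃p' hl₃p₃ h hmp₃ o hl₃o)
  have hYX : ∀ z ∈ Y, z ∉ X := fun z hz => hb.mem_right_iff.1 hz
  have hp'Y : p' ∉ Y := hb.mem_left_iff.1 hp'X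
  let A : Finset V := insert l₁ (insert l₂ (insert l₃ (insert o (insert p₁ (insert x
    (insert p₃ T))))))
  have hoA : o ∈ A := by simp [A]
  have hlink : ∀ i : A, Relation.ReflTransGen (fun i j : A => G.Adj i.1 j.1) ⟨o, hoA⟩ i := by
    have h₁ : Relation.ReflTransGen (fun i j : A => G.Adj i.1 j.1) ⟨o, hoA⟩ ⟨l₁, by simp [A]⟩ :=
      .single hl₁o.symm
    have h₂ : Relation.ReflTransGen (fun i j : A => G.Adj i.1 j.1) ⟨o, hoA⟩ ⟨l₂, by simp [A]⟩ :=
      .single hl₂o.symm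
    have h₃ : Relation.ReflTransGen (fun i j : A => G.Adj i.1 j.1) ⟨o, hoA⟩ ⟨l₃, by simp [A]⟩ :=
      .single hl₃o.symm
    rintro ⟨i, hi⟩
    have hi' := hi
    simp only [A, Finset.mem_insert] at hi'
    rcases hi' with rfl | rfl | rfl | rfl | rfl | rfl | rfl | hiT
    · exact h₁
    · exact h₂
    · exact h₃
    · exact .refl
    · exact h₁.tail hl₁p₁
    · exact h₂.tail hl₂x
    · exact h₃.tail hl₃p₃
    · exact h₁.tail (hl₁T i hiT)
  obtain ⟨ψ, hψ, hψp, hψA⟩ := hc.exists_aut_replace hb A hp₃X hp'X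
    (by
      simp only [A, Finset.mem_insert, not_or]
      refine ⟨?_, ?_, ?_, hp'o, ?_, ?_, hp'p₃, hp'T⟩
      · rintro rfl; exact hp'Y hl₁
      · rintro rfl; exact hp'Y hl₂
      · rintro rfl; exact hp'Y hl₃
      · rintro rfl; exact hl₁p' hl₁p₁
      · rintro rfl; exact hl₂p' hl₂x)
    (by
      intro j hj hjp
      have hX : j ∈ X → (G.Adj p₃ j ↔ G.Adj p' j) := fun h => by
        simp [hb.not_adj_left hp₃X h, hb.not_adj_left hp'X h]
      simp only [A, Finset.mem_insert] at hj
      rcases hj with rfl | rfl | rfl | rfl | rfl | rfl | rfl | hjT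
      · simp [G.adj_comm _ j, hl₁p₃, hl₁p']
      · simp [G.adj_comm _ j, hl₂p₃, hl₂p']
      · simp [G.adj_comm _ j, hl₃p₃, hl₃p']
      · exact hX hoX
      · exact hX hp₁X
      · exact hX hx
      · exact hX hp₃X
      · exact hX (hTX j hjT))
    ⟨o, hoA⟩ hlink
  have hψp' : ψ p₃ = p' := hψp (by simp [A])
  have h₁ : G.Adj (ψ m) p₁ := hψA p₁ (by simp [A]) (Ne.symm hp₃p₁) ▸ ψ.map_adj_iff.2 hmp₁
  have h₂ : G.Adj (ψ m) x := hψA x (by simp [A]) (Ne.symm hp₃x) ▸ ψ.map_adj_iff.2 hmx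
  have h₃ : ∀ u ∈ T, G.Adj (ψ m) u := fun u hu =>
    hψA u (by simp [A, hu]) (fun h => hp₃T (h ▸ hu)) ▸ ψ.map_adj_iff.2 (hmT u hu)
  have h₄ : G.Adj (ψ m) p' := hψp' ▸ ψ.map_adj_iff.2 hmp₃
  exact hmp' (hS' (ψ m) ((hψ.2 m).1 hm) m hm p₁ x hxp₁ hp₁T hxT h₃ hmT h₁ h₂ hmp₁ hmx p' h₄)

/-- If all `k`-sets, `k ≥ 2`, have common neighbours and some vertex is adjacent to all but one
element of a `(k + 1)`-set with a common neighbour, then all `(k + 1)`-sets have one. -/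
lemma commonNbrs_succ (hb : IsBipartition G X Y) (hc : BipCHom G X Y) {k : ℕ} (hk : 2 ≤ k)
    (hP : CommonNbrs G X Y k) {y y' u : V} (hy : y ∈ Y) (hy' : y' ∈ Y) {U : Finset V}
    (hU : U.card = k + 1) (huU : u ∈ U) (hyU : ∀ v ∈ U, G.Adj y v)
    (hy'U : ∀ v ∈ U, G.Adj y' v ↔ v ≠ u) : CommonNbrs G X Y (k + 1) := by
  classical
  intro W hWX hW
  by_contra hcon
  push Not at hcon
  obtain ⟨v, hvU, hvu⟩ := Finset.exists_mem_ne (by omega) u (s := U)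
  obtain ⟨w, hwU, hw⟩ := Finset.exists_mem_notMem_of_card_lt_card (s := {u, v}) (t := U)
    ((Finset.card_le_two).trans_lt (by omega))
  simp only [Finset.mem_insert, Finset.mem_singleton, not_or] at hw
  have hUX : ∀ z ∈ U, z ∈ X := fun z hz => hb.mem_left_of_adj (hyU z hz) hy
  obtain ⟨χ, hχ, -, hχU⟩ := hc.exists_aut_star hb hy hy (fun i : U => i.1)
    (fun i : U => Equiv.swap u v i.1) Subtype.val_injective
    ((Equiv.swap u v).injective.comp Subtype.val_injective) (fun i => hyU i.1 i.2)
    (fun i => by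
      rw [Equiv.swap_apply_def]
      split_ifs
      exacts [hyU v hvU, hyU u huU, hyU i.1 i.2])
  have hy''U : ∀ z ∈ U, G.Adj (χ y') z ↔ z ≠ v := by
    intro z hz
    have hz' : Equiv.swap u v z ∈ U := by
      rw [Equiv.swap_apply_def]
      split_ifs
      exacts [hvU, huU, hz]
    have h := hχU ⟨_, hz'⟩
    simp only [Equiv.swap_apply_self] at h
    rw [← h, χ.map_adj_iff, hy'U _ hz', Ne, h, Ne, not_iff_not, Equiv.swap_apply_eq_iff,
      Equiv.swap_apply_left]
  have hy''Y : χ y' ∈ Y := (hχ.2 _).1 hy'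
  let e : U ≃ W := Finset.equivOfCardEq (hU.trans hW.symm)
  have hgood : ∀ i : U, ∃ z ∈ Y, ∀ j : U, G.Adj z (e j) ↔ j ≠ i := by
    intro i
    obtain ⟨z, hz, hz'⟩ := hP (W.erase (e i))
      (fun a ha => hWX (Finset.mem_of_mem_erase ha))
      (by rw [Finset.card_erase_of_mem (e i).2, hW]; rfl)
    have hz'' : ∀ j : U, j ≠ i → G.Adj z (e j) := fun j hj =>
      hz' _ (Finset.mem_erase.2 ⟨fun h => hj (e.injective (Subtype.ext h)), (e j).2⟩)
    refine ⟨z, hz, fun j => ⟨?_, hz'' j⟩⟩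
    rintro h rfl
    obtain ⟨q, hq, hzq⟩ := hcon z hz
    by_cases hqe : q = e j
    · exact hzq (hqe ▸ h)
    · exact hzq (hz' q (Finset.mem_erase.2 ⟨hqe, hq⟩))
  obtain ⟨z₁, hz₁, hz₁'⟩ := hgood ⟨u, huU⟩
  obtain ⟨z₂, hz₂, hz₂'⟩ := hgood ⟨v, hvU⟩
  have heX : ∀ j : U, (e j : V) ∈ X := fun j => hWX (e j).2
  have hneX : ∀ a ∈ X, ∀ b ∈ Y, a ≠ b := by
    rintro a ha b hb' rfl
    exact hb.mem_right_iff.1 hb' ha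
  have hne' : y' ≠ χ y' := by
    intro h
    have := (hy''U u huU).2 hvu.symm
    rw [← h, hy'U u huU] at this
    exact this rfl
  have hnez : z₁ ≠ z₂ := by
    intro h
    have := (hz₂' ⟨u, huU⟩).2 (by simpa using hvu.symm)
    rw [← h, hz₁'] at this
    exact this rfl
  obtain ⟨ψ, hψ, hψ'⟩ := hc.exists_aut (ι := U ⊕ Bool) hb
    (Sum.elim (fun i => i.1) (fun c => bif c then y' else χ y'))
    (Sum.elim (fun i => (e i).1) (fun c => bif c then z₁ else z₂))
    (by
      have h1 : ∀ i : U, i.1 ≠ y' := fun i => hneX _ (hUX _ i.2) _ hy'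
      have h2 : ∀ i : U, i.1 ≠ χ y' := fun i => hneX _ (hUX _ i.2) _ hy''Y
      have h3 : ∀ i : U, (e i).1 ≠ z₁ := fun i => hneX _ (heX i) _ hz₁
      have h4 : ∀ i : U, (e i).1 ≠ z₂ := fun i => hneX _ (heX i) _ hz₂
      rintro (i | _ | _) (j | _ | _)
      · simp
      all_goals simp [h1, h2, h3, h4, (h1 _).symm, (h2 _).symm, (h3 _).symm, (h4 _).symm, hne',
        hne'.symm, hnez, hnez.symm])
    (by
      rintro (i | _ | _) (j | _ | _)
      · simp [hb.not_adj_left (hUX _ i.2) (hUX _ j.2), hb.not_adj_left (heX i) (heX j)]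
      · simp [G.adj_comm i.1, G.adj_comm (e i).1, hy''U, hz₂', Subtype.ext_iff]
      · simp [G.adj_comm i.1, G.adj_comm (e i).1, hy'U, hz₁', Subtype.ext_iff]
      · simp [hy''U, hz₂', Subtype.ext_iff]
      · simp
      · simp [hb.not_adj_right hy''Y hy', hb.not_adj_right hz₂ hz₁]
      · simp [hy'U, hz₁', Subtype.ext_iff]
      · simp [hb.not_adj_right hy' hy''Y, hb.not_adj_right hz₁ hz₂]
      · simp)
    (by
      have hY : ∀ z ∈ Y, z ∉ X := fun z hz => hb.mem_right_iff.1 hz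
      rintro (i | _ | _)
      · simp [hUX, heX]
      · simp [hY _ hy''Y, hY _ hz₂]
      · simp [hY _ hy', hY _ hz₁])
    (Sum.inl ⟨w, hwU⟩)
    (by
      have h₁ : Relation.ReflTransGen (fun i j : U ⊕ Bool =>
          G.Adj (Sum.elim (fun i => i.1) (fun c => bif c then y' else χ y') i)
            (Sum.elim (fun i => i.1) (fun c => bif c then y' else χ y') j))
          (Sum.inl ⟨w, hwU⟩) (Sum.inr true) :=
        .single (by simpa using ((hy'U w hwU).2 hw.1).symm)
      have h₂ : Relation.ReflTransGen (fun i j : U ⊕ Bool =>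
          G.Adj (Sum.elim (fun i => i.1) (fun c => bif c then y' else χ y') i)
            (Sum.elim (fun i => i.1) (fun c => bif c then y' else χ y') j))
          (Sum.inl ⟨w, hwU⟩) (Sum.inr false) :=
        .single (by simpa using ((hy''U w hwU).2 hw.2).symm)
      rintro (i | _ | _)
      · by_cases hi : i.1 = u
        · refine h₂.tail ?_
          simpa [hy''U, hi, huU] using hvu.symm
        · refine h₁.tail ?_
          simp [hy'U, hi]
      · exact h₂
      · exact h₁)
  obtain ⟨q, hq, hyq⟩ := hcon (ψ y) ((hψ.2 y).1 hy)
  have h := hψ' (Sum.inl (e.symm ⟨q, hq⟩))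
  simp only [Sum.elim_inl, Equiv.apply_symm_apply] at h
  exact hyq (h ▸ ψ.map_adj_iff.2 (hyU _ (e.symm ⟨q, hq⟩).2))

lemma CommonNbrs.exists_adj_adj (h : CommonNbrs G X Y 2) {a b : V} (ha : a ∈ X) (hb : b ∈ X)
    (hab : a ≠ b) : ∃ y ∈ Y, G.Adj y a ∧ G.Adj y b := by
  classical
  obtain ⟨y, hy, hyU⟩ := h {a, b} (by simp [insert_subset_iff, ha, hb]) (Finset.card_pair hab)
  exact ⟨y, hy, hyU a (by simp), hyU b (by simp)⟩

/-- Any two pairs of vertices of `Y` are equivalent if pairs in `Y` have common neighbours. -/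
lemma BipCHom.exists_aut_pair (hb : IsBipartition G X Y) (hc : BipCHom G X Y)
    (hP : CommonNbrs G Y X 2) {a b c d : V} (ha : a ∈ Y) (hb' : b ∈ Y) (hc' : c ∈ Y) (hd : d ∈ Y)
    (hab : a ≠ b) (hcd : c ≠ d) :
    ∃ ψ : G ≃g G, PreservesSides X Y ψ ∧ ψ a = c ∧ ψ b = d := by
  obtain ⟨x, hx, hxa, hxb⟩ := hP.exists_adj_adj ha hb' hab
  obtain ⟨x', hx', hxc, hxd⟩ := hP.exists_adj_adj hc' hd hcd
  obtain ⟨ψ, hψ, -, hψ'⟩ := hc.symm.exists_aut_star hb.symm hx hx' ![a, b] ![c, d]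
    (by intro i j; fin_cases i <;> fin_cases j <;> simp [hab, hab.symm])
    (by intro i j; fin_cases i <;> fin_cases j <;> simp [hcd, hcd.symm])
    (by intro i; fin_cases i <;> simp [hxa, hxb])
    (by intro i; fin_cases i <;> simp [hxc, hxd])
  exact ⟨ψ, hψ.swap, hψ' 0, hψ' 1⟩

lemma isCPGraph_of_existsUnique (hb : IsBipartition G X Y) (hc : BipCHom G X Y)
    (hP : CommonNbrs G Y X 2) {y₀ : V} (hy₀ : y₀ ∈ Y) (hdeg : ∃ x ∈ X, G.Adj y₀ x)
    (h : ∀ y ∈ Y, ∃! x, x ∈ X ∧ ¬ G.Adj x y) : IsCPGraph G := by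
  choose! g hg hg' using h
  have hg'' : ∀ y ∈ Y, ∀ x ∈ X, ¬ G.Adj x y → x = g y := fun y hy x hx hxy => hg' y hy x ⟨hx, hxy⟩
  have hequiv : ∀ ψ : G ≃g G, PreservesSides X Y ψ → ∀ y ∈ Y, ψ (g y) = g (ψ y) := by
    intro ψ hψ y hy
    refine hg'' _ ((hψ.2 y).1 hy) _ ((hψ.1 _).1 (hg y hy).1) ?_
    rw [ψ.map_adj_iff]
    exact (hg y hy).2
  have hsurj : ∀ x ∈ X, ∃ y ∈ Y, g y = x := by
    intro x hx
    obtain ⟨ψ, hψ, hψx⟩ := hc.symm.exists_aut_vertex hb.symm (hg y₀ hy₀).1 hx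
    exact ⟨ψ y₀, (hψ.1 _).1 hy₀, by rw [← hequiv ψ hψ.swap y₀ hy₀, hψx]⟩
  have hinj : ∀ y ∈ Y, ∀ y' ∈ Y, g y = g y' → y = y' := by
    intro y hy y' hy' hyy
    by_contra hne
    obtain ⟨x, hx, hx₀⟩ := hdeg
    obtain ⟨y₁, hy₁, rfl⟩ := hsurj x hx
    have hne' : y₀ ≠ y₁ := by
      rintro rfl
      exact (hg y₀ hy₀).2 hx₀.symm
    obtain ⟨ψ, hψ, h1, h2⟩ := hc.exists_aut_pair hb hP hy hy' hy₀ hy₁ hne hne'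
    have h3 := hequiv ψ hψ y hy
    rw [hyy, hequiv ψ hψ y' hy', h1, h2] at h3
    exact (hg y₀ hy₀).2 (h3 ▸ hx₀.symm)
  let f : Y → X := fun y => ⟨g y, (hg y y.2).1⟩
  have hf : Function.Bijective f := by
    constructor
    · intro y y' hyy
      exact Subtype.ext (hinj _ y.2 _ y'.2 (congrArg Subtype.val hyy))
    · rintro ⟨x, hx⟩
      obtain ⟨y, hy, rfl⟩ := hsurj x hx
      exact ⟨⟨y, hy⟩, rfl⟩
  refine ⟨Y, X, hb.symm, Equiv.ofBijective f hf, fun y x => ?_⟩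
  constructor
  · intro hadj hxy
    refine (hg y y.2).2 ?_
    have : (x : V) = g y := hxy
    rw [← this]
    exact hadj.symm
  · intro hne
    by_contra hadj
    exact hne (hg'' y y.2 x x.2 fun h => hadj h.symm)

/-- It is impossible that all `s`-subsets of `X`, `2 ≤ s ≤ |X| - 2`, are neighbourhoods (or all are
complements of neighbourhoods) if any two pairs in `Y` are equivalent. -/
lemma false_of_forall_card_eq (hb : IsBipartition G X Y) (hc : BipCHom G X Y)
    (hP : CommonNbrs G Y X 2) {p : Prop} {t : ℕ} {Z : Finset V} (hZX : ↑Z ⊆ X)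
    (hZ : Z.card = t + 4)
    (h : ∀ U : Finset V, ↑U ⊆ X → U.card = t + 2 → ∃ y ∈ Y, ∀ x ∈ X, (G.Adj y x ↔ p) ↔ x ∈ U) :
    False := by
  classical
  obtain ⟨a, Z₁, ha, rfl, hZ₁⟩ := Finset.card_eq_succ.1 hZ
  obtain ⟨b, Z₂, hb', rfl, hZ₂⟩ := Finset.card_eq_succ.1 hZ₁
  obtain ⟨c, Z₃, hc', rfl, hZ₃⟩ := Finset.card_eq_succ.1 hZ₂
  obtain ⟨d, W, hd, rfl, hW⟩ := Finset.card_eq_succ.1 hZ₃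
  simp only [Finset.mem_insert, not_or] at ha hb' hc'
  simp only [Finset.coe_insert, insert_subset_iff] at hZX
  obtain ⟨haX, hbX, hcX, hdX, hWX⟩ := hZX
  have hset : ∀ e ∈ X, ∀ f ∈ X, e ≠ f → e ∉ W → f ∉ W →
      ∃ y ∈ Y, ∀ x ∈ X, (G.Adj y x ↔ p) ↔ x ∈ insert e (insert f W) := by
    intro e he f hf hef heW hfW
    refine h _ ?_ ?_
    · simp [insert_subset_iff, he, hf, hWX]
    · rw [Finset.card_insert_of_notMem (by simp [hef, heW]), Finset.card_insert_of_notMem hfW, hW]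
  obtain ⟨y₁, hy₁, h₁⟩ := hset a haX b hbX ha.1 ha.2.2.2 hb'.2.2
  obtain ⟨y₂, hy₂, h₂⟩ := hset a haX c hcX ha.2.1 ha.2.2.2 hc'.2
  obtain ⟨y₃, hy₃, h₃⟩ := hset c hcX d hdX hc'.1 hc'.2 hd
  have h12 : y₁ ≠ y₂ := by
    rintro rfl
    have := (h₁ b hbX).2 (by simp)
    rw [h₂ b hbX] at this
    simp [hb', Ne.symm ha.1] at this
  have h13 : y₁ ≠ y₃ := by
    rintro rfl
    have := (h₁ b hbX).2 (by simp)
    rw [h₃ b hbX] at this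
    simp [hb'] at this
  obtain ⟨ψ, hψ, hψ₁, hψ₂⟩ := hc.exists_aut_pair hb hP hy₁ hy₂ hy₁ hy₃ h12 h13
  have hkey : ∀ x ∈ insert a W, ψ x ∈ W := by
    intro x hx
    have hxX : x ∈ X := by
      rcases Finset.mem_insert.1 hx with rfl | hx
      exacts [haX, hWX hx]
    have hx₁ : x ∈ insert a (insert b W) := by
      simp only [Finset.mem_insert] at hx ⊢; tauto
    have hx₂ : x ∈ insert a (insert c W) := by
      simp only [Finset.mem_insert] at hx ⊢; tauto
    rw [← h₁ x hxX, ← ψ.map_adj_iff, hψ₁, h₁ _ ((hψ.1 x).1 hxX)] at hx₁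
    rw [← h₂ x hxX, ← ψ.map_adj_iff, hψ₂, h₃ _ ((hψ.1 x).1 hxX)] at hx₂
    simp only [Finset.mem_insert] at hx₁ hx₂
    rcases hx₁ with hx₁ | hx₁ | hx₁
    · rw [hx₁] at hx₂
      rcases hx₂ with hx₂ | hx₂ | hx₂
      exacts [absurd hx₂ ha.2.1, absurd hx₂ ha.2.2.1, absurd hx₂ ha.2.2.2]
    · rw [hx₁] at hx₂
      rcases hx₂ with hx₂ | hx₂ | hx₂
      exacts [absurd hx₂ hb'.1, absurd hx₂ hb'.2.1, absurd hx₂ hb'.2.2]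
    · exact hx₁
  have hcard := Finset.card_le_card_of_injOn ψ hkey ψ.injective.injOn
  rw [Finset.card_insert_of_notMem ha.2.2.2] at hcard
  omega

/-- A bounded set of `X` can be mapped to any other one of the same size. -/
lemma BipCHom.exists_aut_finset (hb : IsBipartition G X Y) (hc : BipCHom G X Y) {U W : Finset V}
    (hUW : U.card = W.card) {y z : V} (hy : y ∈ Y) (hz : z ∈ Y) (hyU : ∀ u ∈ U, G.Adj y u)
    (hzW : ∀ w ∈ W, G.Adj z w) :
    ∃ ψ : G ≃g G, PreservesSides X Y ψ ∧ ψ y = z ∧ ∀ x, ψ x ∈ W ↔ x ∈ U := by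
  obtain ⟨ψ, hψ, hψy, hψU⟩ := hc.exists_aut_star hb hy hz (fun i : U => i.1)
    (fun i : U => (Finset.equivOfCardEq hUW i).1) Subtype.val_injective
    (Subtype.val_injective.comp (Equiv.injective _)) (fun i => hyU _ i.2) (fun i => hzW _ (Subtype.property _))
  refine ⟨ψ, hψ, hψy, fun x => ⟨fun hx => ?_, fun hx => ?_⟩⟩
  · have := hψU ((Finset.equivOfCardEq hUW).symm ⟨ψ x, hx⟩)
    rw [Equiv.apply_symm_apply] at this
    rw [← ψ.injective this]
    exact Subtype.property _
  · exact hψU ⟨x, hx⟩ ▸ Subtype.property _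

lemma BipCHom.existsUnique_not_adj (hb : IsBipartition G X Y) (hc : BipCHom G X Y) {y z : V}
    (hy : y ∈ Y) (hz : z ∈ Y) (h : ∃! x, x ∈ X ∧ ¬ G.Adj x y) : ∃! x, x ∈ X ∧ ¬ G.Adj x z := by
  obtain ⟨ψ, hψ, rfl⟩ := hc.exists_aut_vertex hb hy hz
  obtain ⟨x, ⟨hx, hxy⟩, huniq⟩ := h
  refine ⟨ψ x, ⟨(hψ.1 x).1 hx, by rwa [ψ.map_adj_iff]⟩, ?_⟩
  rintro w ⟨hw, hwy⟩
  obtain ⟨w, rfl⟩ := ψ.surjective w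
  rw [ψ.map_adj_iff] at hwy
  rw [huniq w ⟨(hψ.1 w).2 hw, hwy⟩]

lemma isCPGraph_of_not_commonNbrs (hb : IsBipartition G X Y) (hc : BipCHom G X Y)
    (hne : ∃ x ∈ X, ∃ y ∈ Y, ¬ G.Adj x y) (hP1 : CommonNbrs G X Y 1) (hPX : CommonNbrs G X Y 2)
    (hPY : CommonNbrs G Y X 2) {n : ℕ} (hn : ¬ CommonNbrs G X Y n) : IsCPGraph G := by
  classical
  obtain ⟨x₀, hx₀, y₀, hy₀, hxy₀⟩ := hne
  have h0 : CommonNbrs G X Y 0 := by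
    intro U _ hU
    rw [Finset.card_eq_zero] at hU
    exact ⟨y₀, hy₀, by simp [hU]⟩
  obtain ⟨k, hk, hPk, hPk'⟩ : ∃ k, 2 ≤ k ∧ CommonNbrs G X Y k ∧ ¬ CommonNbrs G X Y (k + 1) := by
    have hex : ∃ n, ¬ CommonNbrs G X Y n := ⟨n, hn⟩
    have h1 := Nat.find_spec hex
    obtain ⟨k, hk⟩ : ∃ k, Nat.find hex = k + 1 :=
      Nat.exists_eq_succ_of_ne_zero fun h => by rw [h] at h1; exact h1 h0
    have h2 : CommonNbrs G X Y k := not_not.1 (Nat.find_min hex (by omega))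
    rw [hk] at h1
    refine ⟨k, ?_, h2, h1⟩
    by_contra hlt
    obtain rfl | rfl : k = 0 ∨ k = 1 := by omega
    · exact h1 hP1
    · exact h1 hPX
  obtain ⟨t, rfl⟩ := Nat.exists_eq_add_of_le' hk
  by_cases hbig : ∃ y ∈ Y, ∃ U : Finset V, U.card = t + 3 ∧ ∀ u ∈ U, G.Adj y u
  · by_cases hS : ∀ y ∈ Y, ∀ y' ∈ Y, ∀ U : Finset V, U.card = t + 2 → (∀ u ∈ U, G.Adj y u) →
      (∀ u ∈ U, G.Adj y' u) → ∀ x, G.Adj y x → G.Adj y' x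
    · exact absurd (adj_of_commonNbrs_of_steiner hb hc hPk hS hbig x₀ hx₀ y₀ hy₀) hxy₀
    · push Not at hS
      obtain ⟨y, hy, y', hy', U, hU, hyU, hy'U, x, hyx, hy'x⟩ := hS
      have hxU : x ∉ U := fun h => hy'x (hy'U x h)
      refine absurd (commonNbrs_succ hb hc hk hPk hy hy' (U := insert x U) (u := x)
        (by rw [Finset.card_insert_of_notMem hxU, hU]) (by simp) ?_ ?_) hPk'
      · simpa only [Finset.mem_insert, forall_eq_or_imp] using ⟨hyx, hyU⟩
      · intro v hv
        rcases Finset.mem_insert.1 hv with rfl | hvU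
        · simpa using hy'x
        · have hvx : v ≠ x := by
            rintro rfl
            exact hxU hvU
          simp [hy'U v hvU, hvx]
  · push Not at hbig
    have hnbr : ∀ U : Finset V, ↑U ⊆ X → U.card = t + 2 →
        ∃ y ∈ Y, ∀ x ∈ X, G.Adj y x ↔ x ∈ U := by
      intro U hUX hU
      obtain ⟨y, hy, hyU⟩ := hPk U hUX hU
      refine ⟨y, hy, fun x hx => ⟨fun hyx => ?_, hyU x⟩⟩
      by_contra hxU
      obtain ⟨u, hu, hyu⟩ := hbig y hy (insert x U) (by rw [Finset.card_insert_of_notMem hxU, hU])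
      rcases Finset.mem_insert.1 hu with rfl | hu
      exacts [hyu hyx, hyu (hyU u hu)]
    by_cases hZ : ∃ Z : Finset V, ↑Z ⊆ X ∧ Z.card = t + 4
    · obtain ⟨Z, hZX, hZ⟩ := hZ
      exact (false_of_forall_card_eq hb hc hPY (p := True) hZX hZ (by simpa using hnbr)).elim
    · have hW : ∃ W : Finset V, ↑W ⊆ X ∧ W.card = t + 2 + 1 := by
        unfold CommonNbrs at hPk'
        push Not at hPk'
        obtain ⟨W, hWX, hW, -⟩ := hPk'
        exact ⟨W, hWX, hW⟩
      obtain ⟨W, hWX, hW⟩ := hW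
      have hXW : ∀ x ∈ X, x ∈ W := by
        intro x hx
        by_contra hxW
        refine hZ ⟨insert x W, by simp [insert_subset_iff, hx, hWX], ?_⟩
        rw [Finset.card_insert_of_notMem hxW, hW]
      obtain ⟨U, hUW, hU⟩ := Finset.exists_subset_card_eq (s := W) (n := t + 2) (by omega)
      obtain ⟨y, hy, hyU⟩ := hnbr U (fun u hu => hWX (hUW hu)) hU
      have hyu : ∃ x ∈ X, G.Adj y x := by
        obtain ⟨u, hu⟩ := Finset.card_pos.1 (by omega : 0 < U.card)
        exact ⟨u, hWX (hUW hu), (hyU u (hWX (hUW hu))).2 hu⟩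
      refine isCPGraph_of_existsUnique hb hc hPY hy hyu ?_
      have huniq : ∃! x, x ∈ X ∧ ¬ G.Adj x y := by
        obtain ⟨q, hq⟩ := Finset.card_eq_one.1
          (show (W \ U).card = 1 by rw [Finset.card_sdiff_of_subset hUW]; omega)
        have hq' : ∀ x, x ∈ X ∧ ¬ G.Adj x y ↔ x = q := by
          intro x
          rw [← Finset.mem_singleton, ← hq, Finset.mem_sdiff, G.adj_comm]
          constructor
          · rintro ⟨h1, h2⟩
            exact ⟨hXW x h1, fun h => h2 ((hyU x h1).2 h)⟩
          · rintro ⟨h1, h2⟩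
            exact ⟨hWX h1, fun h => h2 ((hyU x (hWX h1)).1 h)⟩
        exact ⟨q, (hq' q).2 rfl, fun x hx => (hq' x).1 hx⟩
      exact fun z hz => hc.existsUnique_not_adj hb hy hz huniq

lemma infinite_left_of_commonNbrs (hb : IsBipartition G X Y) (hc : BipCHom G X Y)
    (hne : ∃ x ∈ X, ∃ y ∈ Y, ¬ G.Adj x y) (hP : ∀ n, CommonNbrs G X Y n) : X.Infinite := by
  intro hX
  obtain ⟨x₀, hx₀, y₀, hy₀, hxy₀⟩ := hne
  obtain ⟨y, hy, hyX⟩ := hP _ hX.toFinset (by simp) rfl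
  obtain ⟨ψ, hψ, rfl⟩ := hc.exists_aut_vertex hb hy hy₀
  obtain ⟨x, rfl⟩ := ψ.surjective x₀
  refine hxy₀ (ψ.map_adj_iff.2 (hyX x ?_).symm)
  simpa using (hψ.1 x).2 hx₀

lemma infinite_not_adj_or_isCPGraph (hb : IsBipartition G X Y) (hc : BipCHom G X Y)
    (hne : ∃ x ∈ X, ∃ y ∈ Y, ¬ G.Adj x y) (hP : ∀ n, CommonNbrs G X Y n)
    (hPY : CommonNbrs G Y X 2) :
    (∀ y ∈ Y, {x ∈ X | ¬ G.Adj x y}.Infinite) ∨ IsCPGraph G := by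
  classical
  have hX := infinite_left_of_commonNbrs hb hc hne hP
  by_contra! hcon
  obtain ⟨⟨y, hy, hfin⟩, hCP⟩ := hcon
  obtain ⟨x₀, hx₀, y₀, hy₀, hxy₀⟩ := hne
  have hyS : ∀ x, x ∈ hfin.toFinset ↔ x ∈ X ∧ ¬ G.Adj x y := by simp
  generalize hfin.toFinset = S at hyS
  have hS0 : S.Nonempty := by
    obtain ⟨ψ, hψ, rfl⟩ := hc.exists_aut_vertex hb hy₀ hy
    exact ⟨ψ x₀, (hyS _).2 ⟨(hψ.1 _).1 hx₀, by rwa [ψ.map_adj_iff]⟩⟩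
  obtain hS | hS : S.card = 1 ∨ 2 ≤ S.card := by
    have := hS0.card_pos
    omega
  · obtain ⟨q, rfl⟩ := Finset.card_eq_one.1 hS
    have huniq : ∃! x, x ∈ X ∧ ¬ G.Adj x y :=
      ⟨q, (hyS q).1 (by simp), fun x hx => by simpa using (hyS x).2 hx⟩
    refine hCP (isCPGraph_of_existsUnique hb hc hPY hy ?_
      fun z hz => hc.existsUnique_not_adj hb hy hz huniq)
    obtain ⟨x, hx, hxq⟩ := hX.exists_notMem_finset {q}
    refine ⟨x, hx, ?_⟩
    by_contra hyx
    exact hxq ((hyS x).2 ⟨hx, fun h => hyx h.symm⟩)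
  · obtain ⟨t, ht⟩ := Nat.exists_eq_add_of_le' hS
    obtain ⟨Z, hZX, hZ⟩ := hX.exists_subset_card_eq (t + 4)
    obtain ⟨z, hz, hzS⟩ := hP _ S (fun s hs => ((hyS s).1 hs).1) rfl
    refine false_of_forall_card_eq hb hc hPY (p := False) hZX hZ fun U hUX hU => ?_
    obtain ⟨w, hw, hwU⟩ := hP _ U hUX rfl
    obtain ⟨ψ, hψ, -, hψU⟩ := hc.exists_aut_finset hb (ht.trans hU.symm) hz hw hzS hwU
    refine ⟨ψ y, (hψ.2 y).1 hy, fun x hx => ?_⟩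
    obtain ⟨x, rfl⟩ := ψ.surjective x
    rw [ψ.map_adj_iff, hψU, hyS, G.adj_comm]
    simp [(hψ.1 x).2 hx]

lemma exists_separating_of_commonNbrs (hb : IsBipartition G X Y) (hc : BipCHom G X Y)
    (hP : ∀ n, CommonNbrs G X Y n) (hinf : ∀ y ∈ Y, {x ∈ X | ¬ G.Adj x y}.Infinite)
    (U W : Set V) (hU : U ⊆ X) (hW : W ⊆ X) (hUf : U.Finite) (hWf : W.Finite)
    (hUW : Disjoint U W) :
    ∃ v ∈ Y, (∀ u ∈ U, G.Adj v u) ∧ ∀ w ∈ W, ¬ G.Adj v w := by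
  classical
  lift U to Finset V using hUf
  lift W to Finset V using hWf
  obtain ⟨y, hy, hyU⟩ := hP _ U hU rfl
  obtain ⟨W', hW'X, hW'⟩ := (hinf y hy).exists_subset_card_eq W.card
  have hW'X : ∀ w ∈ W', w ∈ X ∧ ¬ G.Adj w y := fun w hw => hW'X hw
  obtain ⟨z, hz, hzUW⟩ := hP _ (U ∪ W') (by
    intro a ha
    simp only [Finset.coe_union, mem_union, Finset.mem_coe] at ha
    rcases ha with ha | ha
    exacts [hU ha, (hW'X a ha).1]) rfl
  obtain ⟨z', hz', hzUW'⟩ := hP _ (U ∪ W) (by simp [hU, hW]) rfl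
  have hUW'' : ∀ a ∈ U, ∀ b ∈ W', a ≠ b := by
    rintro a ha b hb' rfl
    exact (hW'X a hb').2 (hyU a ha).symm
  have hUW : ∀ a ∈ U, ∀ b ∈ W, a ≠ b := by
    rintro a ha b hb' rfl
    exact Set.disjoint_left.1 hUW ha hb'
  let e : W' ≃ W := Finset.equivOfCardEq hW'
  obtain ⟨ψ, hψ, -, hψ'⟩ := hc.exists_aut_star (ι := U ⊕ W') hb hz hz'
    (Sum.elim (fun i => i.1) (fun i => i.1)) (Sum.elim (fun i => i.1) (fun i => (e i).1))
    (Subtype.val_injective.sumElim Subtype.val_injective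
      fun a b => hUW'' _ a.2 _ b.2)
    (Subtype.val_injective.sumElim (Subtype.val_injective.comp e.injective)
      fun a b => hUW _ a.2 _ (e b).2)
    (by
      rintro (i | i)
      · exact hzUW _ (Finset.mem_union_left _ i.2)
      · exact hzUW _ (Finset.mem_union_right _ i.2))
    (by
      rintro (i | i)
      · exact hzUW' _ (Finset.mem_union_left _ i.2)
      · exact hzUW' _ (Finset.mem_union_right _ (e i).2))
  refine ⟨ψ y, (hψ.2 y).1 hy, fun u hu => ?_, fun w hw => ?_⟩
  · have : ψ u = u := hψ' (Sum.inl ⟨u, hu⟩)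
    rw [← this, ψ.map_adj_iff]
    exact hyU u hu
  · have : ψ (e.symm ⟨w, hw⟩) = w := by
      simpa using hψ' (Sum.inr (e.symm ⟨w, hw⟩))
    rw [← this, ψ.map_adj_iff, G.adj_comm]
    exact (hW'X _ (e.symm ⟨w, hw⟩).2).2

lemma exists_separating_notMem (hX : X.Infinite)
    (h : ∀ U W : Set V, U ⊆ X → W ⊆ X → U.Finite → W.Finite → Disjoint U W →
      ∃ v ∈ Y, (∀ u ∈ U, G.Adj v u) ∧ ∀ w ∈ W, ¬ G.Adj v w) {F : Set V} (hF : F.Finite) :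
    ∀ U W : Set V, U ⊆ X → W ⊆ X → U.Finite → W.Finite → Disjoint U W →
      ∃ v ∈ Y, v ∉ F ∧ (∀ u ∈ U, G.Adj v u) ∧ ∀ w ∈ W, ¬ G.Adj v w := by
  induction F, hF using Set.Finite.induction_on with
  | empty => simpa using h
  | @insert b F _ _ ih =>
    intro U W hU hW hUf hWf hUW
    obtain ⟨x, hx, hxUW⟩ := (hX.sdiff (hUf.union hWf)).nonempty
    simp only [mem_union, not_or] at hxUW
    by_cases hbx : G.Adj b x
    · obtain ⟨v, hv, hvF, hvU, hvW⟩ := ih U (insert x W) hU (insert_subset hx hW) hUf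
        (hWf.insert x) (Set.disjoint_insert_right.2 ⟨hxUW.1, hUW⟩)
      refine ⟨v, hv, ?_, hvU, fun w hw => hvW w (mem_insert_of_mem _ hw)⟩
      rintro (rfl | h)
      exacts [hvW x (mem_insert _ _) hbx, hvF h]
    · obtain ⟨v, hv, hvF, hvU, hvW⟩ := ih (insert x U) W (insert_subset hx hU) hW (hUf.insert x)
        hWf (Set.disjoint_insert_left.2 ⟨hxUW.2, hUW⟩)
      refine ⟨v, hv, ?_, fun w hw => hvU w (mem_insert_of_mem _ hw), hvW⟩
      rintro (rfl | h)
      exacts [hbx (hvU x (mem_insert _ _)), hvF h]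

lemma GenericBip.exists_dominating (hb : IsBipartition G X Y) (hX : X.Infinite) (hY : Y.Infinite)
    (hg : GenericBip G X Y) {A : Set V} (hA : A.Finite) :
    ∃ x ∈ X, ∃ y ∈ Y, x ∉ A ∧ y ∉ A ∧ G.Adj y x ∧ (∀ a ∈ A, G.Adj x a ↔ a ∈ Y) ∧
      ∀ a ∈ A, G.Adj y a ↔ a ∈ X := by
  obtain ⟨x, hx, hxA, hxY, -⟩ := exists_separating_notMem hY hg.2 hA (A ∩ Y) ∅ inter_subset_right
    (empty_subset _) (hA.inter_of_left _) finite_empty (disjoint_empty _)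
  obtain ⟨y, hy, hyA, hyX, -⟩ := exists_separating_notMem hX hg.1 hA (insert x (A ∩ X)) ∅
    (insert_subset hx inter_subset_right) (empty_subset _) ((hA.inter_of_left _).insert x)
    finite_empty (disjoint_empty _)
  exact ⟨x, hx, y, hy, hxA, hyA, hyX x (mem_insert _ _),
    fun a ha => ⟨fun h => hb.mem_right_of_adj h hx, fun h => hxY a ⟨ha, h⟩⟩,
    fun a ha => ⟨fun h => hb.mem_left_of_adj h hy,
      fun h => hyX a (mem_insert_of_mem _ ⟨ha, h⟩)⟩⟩

lemma GenericBip.bipHom (hb : IsBipartition G X Y) (hc : BipCHom G X Y) (hX : X.Infinite)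
    (hY : Y.Infinite) (hg : GenericBip G X Y) : BipHom G X Y := by
  intro A B hA hB φ hadj hφX hφY
  obtain ⟨x, hx, y, hy, hxA, hyA, hyx, hxA', hyA'⟩ := hg.exists_dominating hb hX hY hA
  obtain ⟨x', hx', y', hy', hxB, hyB, hyx', hxB', hyB'⟩ := hg.exists_dominating hb hX hY hB
  have := hA.to_subtype
  have h1 : ∀ i : A, i.1 ≠ y := fun i h => hyA (h ▸ i.2)
  have h2 : ∀ i : A, i.1 ≠ x := fun i h => hxA (h ▸ i.2)
  have h3 : ∀ i : B, i.1 ≠ y' := fun i h => hyB (h ▸ i.2)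
  have h4 : ∀ i : B, i.1 ≠ x' := fun i h => hxB (h ▸ i.2)
  have hyY : y ∉ X := hb.mem_right_iff.1 hy
  have hyY' : y' ∉ X := hb.mem_right_iff.1 hy'
  obtain ⟨ψ, hψ, hψ'⟩ := hc.exists_aut (ι := A ⊕ Bool) hb
    (Sum.elim (fun i => i.1) (fun c => bif c then y else x))
    (Sum.elim (fun i => (φ i).1) (fun c => bif c then y' else x'))
    (by
      rintro (i | _ | _) (j | _ | _)
      · simp [Subtype.val_inj]
      all_goals simp [h1, h2, h3, h4, (h1 _).symm, (h2 _).symm, (h3 _).symm, (h4 _).symm, hyx.ne,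
        hyx.ne', hyx'.ne, hyx'.ne'])
    (by
      rintro (i | _ | _) (j | _ | _)
      · simpa using hadj i j
      · simp [G.adj_comm i.1, G.adj_comm (φ i).1, hxA', hxB', hφY]
      · simp [G.adj_comm i.1, G.adj_comm (φ i).1, hyA', hyB', hφX]
      · simp [hxA', hxB', hφY]
      · simp
      · simp [hyx.symm, hyx'.symm]
      · simp [hyA', hyB', hφX]
      · simp [hyx, hyx']
      · simp)
    (by
      rintro (i | _ | _)
      · simpa using hφX i
      · simp [hx, hx']
      · simp [hyY, hyY'])
    (Sum.inr true)
    (by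
      have h₁ : Relation.ReflTransGen (fun i j : A ⊕ Bool =>
          G.Adj (Sum.elim (fun i => i.1) (fun c => bif c then y else x) i)
            (Sum.elim (fun i => i.1) (fun c => bif c then y else x) j))
          (Sum.inr true) (Sum.inr false) :=
        .single (by simpa using hyx)
      rintro (i | _ | _)
      · rcases hb.mem_left_or_right i.1 with hi | hi
        · exact .single (by simpa using (hyA' i i.2).2 hi)
        · exact h₁.tail (by simpa using (hxA' i i.2).2 hi)
      · exact h₁
      · exact .refl)
  exact ⟨ψ, hψ.1, hψ.2, fun a => hψ' (Sum.inl a)⟩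

/-- The classification when any two vertices on the same side have a common neighbour. -/
lemma classification_of_commonNbrs_two (hb : IsBipartition G X Y) (hc : BipCHom G X Y)
    (hne : ∃ x ∈ X, ∃ y ∈ Y, ¬ G.Adj x y) (hX : CommonNbrs G X Y 1) (hY : CommonNbrs G Y X 1)
    (hX' : CommonNbrs G X Y 2) (hY' : CommonNbrs G Y X 2) : IsCPGraph G ∨ IsHomGenericBip G := by
  have hne' : ∃ y ∈ Y, ∃ x ∈ X, ¬ G.Adj y x := by
    obtain ⟨x, hx, y, hy, h⟩ := hne
    exact ⟨y, hy, x, hx, fun h' => h h'.symm⟩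
  by_contra! hcon
  obtain ⟨hCP, hgen⟩ := hcon
  have hPX : ∀ n, CommonNbrs G X Y n := fun n => by
    by_contra hn
    exact hCP (isCPGraph_of_not_commonNbrs hb hc hne hX hX' hY' hn)
  have hPY : ∀ n, CommonNbrs G Y X n := fun n => by
    by_contra hn
    exact hCP (isCPGraph_of_not_commonNbrs hb.symm hc.symm hne' hY hY' hX' hn)
  have hg : GenericBip G X Y :=
    ⟨exists_separating_of_commonNbrs hb hc hPX
      ((infinite_not_adj_or_isCPGraph hb hc hne hPX hY').resolve_right hCP),
    exists_separating_of_commonNbrs hb.symm hc.symm hPY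
      ((infinite_not_adj_or_isCPGraph hb.symm hc.symm hne' hPY hX').resolve_right hCP)⟩
  exact hgen ⟨X, Y, hb, hg, hg.bipHom hb hc (infinite_left_of_commonNbrs hb hc hne hPX)
    (infinite_left_of_commonNbrs hb.symm hc.symm hne' hPY)⟩

/-- The first `k + 1` terms of `p` form a path. -/
def IsPathSeq (G : SimpleGraph V) (k : ℕ) (p : ℕ → V) : Prop :=
  (∀ i ≤ k, ∀ j ≤ k, p i = p j → i = j) ∧ ∀ i < k, G.Adj (p i) (p (i + 1))

/-- The first `k + 1` terms of `p` form an induced path. -/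
def IsInducedPathSeq (G : SimpleGraph V) (k : ℕ) (p : ℕ → V) : Prop :=
  (∀ i ≤ k, ∀ j ≤ k, p i = p j → i = j) ∧
    ∀ i ≤ k, ∀ j ≤ k, G.Adj (p i) (p j) ↔ i + 1 = j ∨ j + 1 = i

/-- Among the closed paths with more than two vertices those with `k + 1` vertices are shortest. -/
def IsMinClosed (G : SimpleGraph V) (k : ℕ) : Prop :=
  ∀ l p, 2 ≤ l → IsPathSeq G l p → G.Adj (p l) (p 0) → k ≤ l

lemma IsInducedPathSeq.isPathSeq {k : ℕ} {p : ℕ → V} (h : IsInducedPathSeq G k p) :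
    IsPathSeq G k p :=
  ⟨h.1, fun i hi => (h.2 i hi.le (i + 1) hi).2 (Or.inl rfl)⟩

lemma IsPathSeq.mono {k l : ℕ} {p : ℕ → V} (h : IsPathSeq G k p) (hl : l ≤ k) :
    IsPathSeq G l p :=
  ⟨fun i hi j hj => h.1 i (hi.trans hl) j (hj.trans hl), fun i hi => h.2 i (hi.trans_le hl)⟩

lemma IsPathSeq.shift {k : ℕ} {p : ℕ → V} (i : ℕ) (h : IsPathSeq G (i + k) p) :
    IsPathSeq G k (fun n => p (i + n)) :=
  ⟨fun a ha b hb hab => by have := h.1 (i + a) (by omega) (i + b) (by omega) hab; omega,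
    fun a ha => h.2 (i + a) (by omega)⟩

lemma IsPathSeq.map {k : ℕ} {p : ℕ → V} (h : IsPathSeq G k p) (ψ : G ≃g G) :
    IsPathSeq G k (ψ ∘ p) :=
  ⟨fun i hi j hj hij => h.1 i hi j hj (ψ.injective hij), fun i hi => ψ.map_adj_iff.2 (h.2 i hi)⟩

lemma IsPathSeq.mem_iff (hb : IsBipartition G X Y) {k : ℕ} {p : ℕ → V} (h : IsPathSeq G k p)
    {i : ℕ} (hi : i ≤ k) : p i ∈ X ↔ (p 0 ∈ X ↔ Even i) := by
  induction i with
  | zero => simp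
  | succ i ih =>
    have h1 := ih (by omega)
    have h2 := hb.not_mem_of_adj (h.2 i hi)
    rw [Nat.even_add_one]
    tauto

lemma IsMinClosed.le_sub {k l : ℕ} (hk : IsMinClosed G k) {p : ℕ → V} (h : IsPathSeq G l p)
    {i j : ℕ} (hij : i + 2 ≤ j) (hj : j ≤ l) (hadj : G.Adj (p i) (p j)) : k ≤ j - i := by
  refine hk (j - i) (fun n => p (i + n)) (by omega)
    (IsPathSeq.shift i (h.mono (by omega))) ?_
  rw [add_zero, Nat.add_sub_cancel' (by omega)]
  exact hadj.symm

lemma IsMinClosed.isInducedPathSeq {k l : ℕ} (hk : IsMinClosed G k) {p : ℕ → V}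
    (h : IsPathSeq G l p) (hl : l < k) : IsInducedPathSeq G l p := by
  refine ⟨h.1, fun i hi j hj => ⟨fun hadj => ?_, ?_⟩⟩
  · by_contra! hcon
    have hne : i ≠ j := by rintro rfl; exact hadj.ne rfl
    obtain hij | hij : i + 2 ≤ j ∨ j + 2 ≤ i := by omega
    · have := hk.le_sub h hij hj hadj
      omega
    · have := hk.le_sub h hij hi hadj.symm
      omega
  · rintro (rfl | rfl)
    exacts [h.2 i hj, (h.2 j hi).symm]

lemma BipCHom.exists_aut_path (hb : IsBipartition G X Y) (hc : BipCHom G X Y) {k : ℕ}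
    {p q : ℕ → V} (hp : IsInducedPathSeq G k p) (hq : IsInducedPathSeq G k q)
    (h0 : p 0 ∈ X ↔ q 0 ∈ X) :
    ∃ ψ : G ≃g G, PreservesSides X Y ψ ∧ ∀ i ≤ k, ψ (p i) = q i := by
  obtain ⟨ψ, hψ, hψ'⟩ := hc.exists_aut (ι := Fin (k + 1)) hb (fun i => p i) (fun i => q i)
    (fun i j => ⟨fun h => by rw [hp.1 i (by omega) j (by omega) h],
      fun h => by rw [hq.1 i (by omega) j (by omega) h]⟩)
    (fun i j => by rw [hp.2 i (by omega) j (by omega), hq.2 i (by omega) j (by omega)])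
    (fun i => by
      rw [hp.isPathSeq.mem_iff hb (by omega), hq.isPathSeq.mem_iff hb (by omega), h0])
    0
    (fun i => by
      obtain ⟨i, hi⟩ := i
      induction i with
      | zero => exact .refl
      | succ i ih => exact (ih (by omega)).tail (hp.isPathSeq.2 i (by omega)))
  exact ⟨ψ, hψ, fun i hi => hψ' ⟨i, by omega⟩⟩

/-- The path sequence with five prescribed vertices. -/
def seqFive (a₀ a₁ a₂ a₃ a₄ : V) : ℕ → V
  | 0 => a₀
  | 1 => a₁
  | 2 => a₂
  | 3 => a₃
  | _ => a₄

lemma isInducedPathSeq_five (hb : IsBipartition G X Y) {a₀ a₁ a₂ a₃ a₄ : V} (h₀ : a₀ ∈ X)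
    (h01 : G.Adj a₀ a₁) (h12 : G.Adj a₁ a₂) (h23 : G.Adj a₂ a₃) (h34 : G.Adj a₃ a₄)
    (h03 : ¬ G.Adj a₀ a₃) (h14 : ¬ G.Adj a₁ a₄) :
    IsInducedPathSeq G 4 (seqFive a₀ a₁ a₂ a₃ a₄) := by
  have h₁ := hb.mem_right_of_adj h01 h₀
  have h₂ := hb.mem_left_of_adj h12 h₁
  have h₃ := hb.mem_right_of_adj h23 h₂
  have h₄ := hb.mem_left_of_adj h34 h₃
  have n02 : a₀ ≠ a₂ := by rintro rfl; exact h03 h23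
  have n04 : a₀ ≠ a₄ := by rintro rfl; exact h03 h34.symm
  have n24 : a₂ ≠ a₄ := by rintro rfl; exact h14 h12
  have n13 : a₁ ≠ a₃ := by rintro rfl; exact h03 h01
  have n03 : a₀ ≠ a₃ := by rintro rfl; exact hb.mem_right_iff.1 h₃ h₀
  have n14 : a₁ ≠ a₄ := by rintro rfl; exact hb.mem_right_iff.1 h₁ h₄
  have e02 := hb.not_adj_left h₀ h₂
  have e04 := hb.not_adj_left h₀ h₄
  have e24 := hb.not_adj_left h₂ h₄
  have e13 := hb.not_adj_right h₁ h₃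
  constructor
  · intro i hi j hj h
    interval_cases i <;> interval_cases j <;>
      simp [seqFive, h01.ne, h12.ne, h23.ne, h34.ne, h01.ne', h12.ne', h23.ne', h34.ne', n02, n04,
        n24, n13, n03, n14, n02.symm, n04.symm, n24.symm, n13.symm, n03.symm, n14.symm] at h ⊢
  · intro i hi j hj
    interval_cases i <;> interval_cases j <;>
      simp [seqFive, h01, h12, h23, h34, h01.symm, h12.symm, h23.symm, h34.symm, h03, h14,
        e02, e04, e24, e13, G.adj_comm a₃ a₀, G.adj_comm a₄ a₁, G.adj_comm a₂ a₀,
        G.adj_comm a₄ a₀, G.adj_comm a₄ a₂, G.adj_comm a₃ a₁]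

/-- If the ends of induced paths with five vertices have common neighbours, then so do any two
vertices on the same side. -/
lemma commonNbrs_two_of_path (hconn : G.Connected) (hb : IsBipartition G X Y)
    (H : ∀ a₀ a₁ a₂ a₃ a₄, a₀ ∈ X → G.Adj a₀ a₁ → G.Adj a₁ a₂ → G.Adj a₂ a₃ → G.Adj a₃ a₄ →
      ¬ G.Adj a₀ a₃ → ¬ G.Adj a₁ a₄ → ∃ w, G.Adj w a₀ ∧ G.Adj w a₄) : CommonNbrs G X Y 2 := by
  classical
  intro U hUX hU
  obtain ⟨x, z, hxz, rfl⟩ := Finset.card_eq_two.1 hU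
  simp only [Finset.coe_insert, Finset.coe_singleton, insert_subset_iff,
    singleton_subset_iff] at hUX
  obtain ⟨hx, hz⟩ := hUX
  have key := hconn.forall_of_adj (v := x) (p := fun z =>
      (z ∈ X → z = x ∨ ∃ w, G.Adj w x ∧ G.Adj w z) ∧
      (z ∈ Y → ∃ x', G.Adj x' z ∧ (x' = x ∨ ∃ w, G.Adj w x ∧ G.Adj w x')))
    ⟨fun _ => Or.inl rfl, fun h => absurd hx (hb.mem_right_iff.1 h)⟩
    (by
      rintro a b ⟨h1, h2⟩ hab
      refine ⟨fun hbX => ?_, fun hbY => ?_⟩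
      · obtain ⟨x', hx'a, rfl | ⟨w, hwx, hwx'⟩⟩ := h2 (hb.mem_right_of_adj hab.symm hbX)
        · exact Or.inr ⟨a, hx'a.symm, hab⟩
        · by_cases hxa : G.Adj x a
          · exact Or.inr ⟨a, hxa.symm, hab⟩
          by_cases hwb : G.Adj w b
          · exact Or.inr ⟨w, hwx, hwb⟩
          exact Or.inr (H x w x' a b hx hwx.symm hwx' hx'a hab hxa hwb)
      · exact ⟨a, hab, h1 (hb.mem_left_of_adj hab.symm hbY)⟩) z
  obtain rfl | ⟨w, hwx, hwz⟩ := key.1 hz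
  · exact absurd rfl hxz
  · exact ⟨w, hb.mem_right_of_adj hwx.symm hx, by simp [hwx, hwz]⟩

lemma exists_path_four (hconn : G.Connected) (hb : IsBipartition G X Y)
    (hne : ∃ x ∈ X, ∃ y ∈ Y, ¬ G.Adj x y) :
    ∃ x₀ y₀ x₁ y₁, x₀ ∈ X ∧ G.Adj x₀ y₀ ∧ G.Adj y₀ x₁ ∧ G.Adj x₁ y₁ ∧ ¬ G.Adj x₀ y₁ := by
  by_contra! hcon
  obtain ⟨x, hx, y, hy, hxy⟩ := hne
  have key := hconn.forall_of_adj (v := x) (p := fun z =>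
      (z ∈ X → z = x ∨ ∃ w, G.Adj x w ∧ G.Adj w z) ∧ (z ∈ Y → G.Adj x z))
    ⟨fun _ => Or.inl rfl, fun h => absurd hx (hb.mem_right_iff.1 h)⟩
    (by
      rintro a b ⟨h1, h2⟩ hab
      refine ⟨fun hbX => Or.inr ⟨a, h2 (hb.mem_right_of_adj hab.symm hbX), hab⟩, fun hbY => ?_⟩
      obtain rfl | ⟨w, hxw, hwa⟩ := h1 (hb.mem_left_of_adj hab.symm hbY)
      · exact hab
      · exact hcon x w a b hx hxw hwa hab) y
  exact hxy (key.2 hy)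

/-- The graph contains a cycle of length four. -/
def HasFourCycle (G : SimpleGraph V) : Prop :=
  ∃ a b c d, a ≠ c ∧ b ≠ d ∧ G.Adj a b ∧ G.Adj b c ∧ G.Adj c d ∧ G.Adj d a

lemma commonNbrs_two_of_hasFourCycle (hconn : G.Connected) (hb : IsBipartition G X Y)
    (hc : BipCHom G X Y) (hne : ∃ x ∈ X, ∃ y ∈ Y, ¬ G.Adj x y) (h4 : HasFourCycle G) :
    CommonNbrs G X Y 2 := by
  obtain ⟨x, hx, x', y, y', hxx, hyy, hyx, hyx', hy'x, hy'x'⟩ : ∃ x ∈ X, ∃ x' y y', x ≠ x' ∧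
      y ≠ y' ∧ G.Adj y x ∧ G.Adj y x' ∧ G.Adj y' x ∧ G.Adj y' x' := by
    obtain ⟨a, b, c, d, hac, hbd, hab, hbc, hcd, hda⟩ := h4
    rcases hb.mem_left_or_right a with ha | ha
    · exact ⟨a, ha, c, b, d, hac, hbd, hab.symm, hbc, hda, hcd.symm⟩
    · exact ⟨b, hb.mem_left_of_adj hab ha, d, a, c, hbd, hac, hab, hda.symm, hbc.symm, hcd⟩
  have hy : y ∈ Y := hb.mem_right_of_adj hyx.symm hx
  obtain ⟨x₀, y₀, x₁, y₁, hx₀, h00, h01, h11, h01'⟩ := exists_path_four hconn hb hne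
  have hy₀ : y₀ ∈ Y := hb.mem_right_of_adj h00 hx₀
  have hx₁ : x₁ ∈ X := hb.mem_left_of_adj h01 hy₀
  have hne01 : x₀ ≠ x₁ := by rintro rfl; exact h01' h11
  obtain ⟨y₂, hy₂, h20, h21⟩ : ∃ y₂, y₂ ≠ y₀ ∧ G.Adj y₂ x₀ ∧ G.Adj y₂ x₁ := by
    obtain ⟨ψ, hψ, h1, h2⟩ := hc.exists_aut_star hb hy hy₀ ![x, x'] ![x₀, x₁]
      (by intro i j; fin_cases i <;> fin_cases j <;> simp [hxx, hxx.symm])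
      (by intro i j; fin_cases i <;> fin_cases j <;> simp [hne01, hne01.symm])
      (by intro i; fin_cases i <;> simp [hyx, hyx'])
      (by intro i; fin_cases i <;> simp [h00.symm, h01])
    have e0 : ψ x = x₀ := h2 0
    have e1 : ψ x' = x₁ := h2 1
    refine ⟨ψ y', ?_, e0 ▸ ψ.map_adj_iff.2 hy'x, e1 ▸ ψ.map_adj_iff.2 hy'x'⟩
    rw [← h1]
    exact fun h => hyy (ψ.injective h).symm
  have n01 : y₀ ≠ y₁ := by rintro rfl; exact h01' h00
  have n21 : y₂ ≠ y₁ := by rintro rfl; exact h01' h20.symm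
  obtain ⟨x₂, hx₂, hx₂2, hx₂1, hx₂0⟩ : ∃ x₂ ∈ X, G.Adj x₂ y₂ ∧ G.Adj x₂ y₁ ∧ ¬ G.Adj x₂ y₀ := by
    obtain ⟨ψ, hψ, h1, h2⟩ := hc.symm.exists_aut_star hb.symm hx₁ hx₁ ![y₀, y₂, y₁] ![y₂, y₁, y₀]
      (by
        intro i j
        fin_cases i <;> fin_cases j <;> simp [n01, n01.symm, n21, n21.symm, hy₂, hy₂.symm])
      (by
        intro i j
        fin_cases i <;> fin_cases j <;> simp [n01, n01.symm, n21, n21.symm, hy₂, hy₂.symm])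
      (by intro i; fin_cases i <;> simp [h01.symm, h21.symm, h11])
      (by intro i; fin_cases i <;> simp [h01.symm, h21.symm, h11])
    have e0 : ψ y₀ = y₂ := h2 0
    have e1 : ψ y₂ = y₁ := h2 1
    have e2 : ψ y₁ = y₀ := h2 2
    refine ⟨ψ x₀, (hψ.2 _).1 hx₀, e0 ▸ ψ.map_adj_iff.2 h00, e1 ▸ ψ.map_adj_iff.2 h20.symm, ?_⟩
    rw [← e2, ψ.map_adj_iff]
    exact h01'
  have hp := isInducedPathSeq_five hb hx₀ h00 h01 h11 hx₂1.symm h01' fun h => hx₂0 h.symm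
  refine commonNbrs_two_of_path hconn hb fun a₀ a₁ a₂ a₃ a₄ ha₀ g01 g12 g23 g34 g03 g14 => ?_
  obtain ⟨ψ, -, hψ⟩ := hc.exists_aut_path hb hp
    (isInducedPathSeq_five hb ha₀ g01 g12 g23 g34 g03 g14) (iff_of_true hx₀ ha₀)
  have e0 : ψ x₀ = a₀ := hψ 0 (by norm_num)
  have e4 : ψ x₂ = a₄ := hψ 4 le_rfl
  exact ⟨ψ y₂, e0 ▸ ψ.map_adj_iff.2 h20, e4 ▸ ψ.map_adj_iff.2 hx₂2.symm⟩

/-- A C-homogeneous bipartite graph with a cycle of length four. -/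
lemma classification_of_hasFourCycle (hconn : G.Connected) (hb : IsBipartition G X Y)
    (hc : BipCHom G X Y) (h4 : HasFourCycle G) :
    IsCompleteBip G ∨ IsCPGraph G ∨ IsHomGenericBip G := by
  by_cases hne : ∃ x ∈ X, ∃ y ∈ Y, ¬ G.Adj x y
  · have hne' : ∃ y ∈ Y, ∃ x ∈ X, ¬ G.Adj y x := by
      obtain ⟨x, hx, y, hy, h⟩ := hne
      exact ⟨y, hy, x, hx, fun h' => h h'.symm⟩
    obtain ⟨a, b, -, -, -, -, hab, -⟩ := id h4
    have : Nontrivial V := ⟨⟨a, b, hab.ne⟩⟩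
    have hone : ∀ X Y : Set V, IsBipartition G X Y → CommonNbrs G X Y 1 := by
      intro X Y hb U hUX hU
      obtain ⟨u, rfl⟩ := Finset.card_eq_one.1 hU
      obtain ⟨w, hw⟩ := hconn.preconnected.exists_adj_of_nontrivial u
      exact ⟨w, hb.mem_right_of_adj hw (hUX (by simp)), by simpa using hw.symm⟩
    exact Or.inr (classification_of_commonNbrs_two hb hc hne (hone X Y hb) (hone Y X hb.symm)
      (commonNbrs_two_of_hasFourCycle hconn hb hc hne h4)
      (commonNbrs_two_of_hasFourCycle hconn hb.symm hc.symm hne' h4))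
  · push Not at hne
    exact Or.inl ⟨X, Y, hb, hne⟩

/-- The path sequence with six prescribed vertices. -/
def seqSix (a₀ a₁ a₂ a₃ a₄ a₅ : V) : ℕ → V
  | 0 => a₀
  | 1 => a₁
  | 2 => a₂
  | 3 => a₃
  | 4 => a₄
  | _ => a₅

lemma isPathSeq_six (hb : IsBipartition G X Y) {a₀ a₁ a₂ a₃ a₄ a₅ : V}
    (h01 : G.Adj a₀ a₁) (h12 : G.Adj a₁ a₂) (h23 : G.Adj a₂ a₃) (h34 : G.Adj a₃ a₄)
    (h45 : G.Adj a₄ a₅) (n02 : a₀ ≠ a₂) (n04 : a₀ ≠ a₄) (n24 : a₂ ≠ a₄) (n13 : a₁ ≠ a₃)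
    (n15 : a₁ ≠ a₅) (n35 : a₃ ≠ a₅) : IsPathSeq G 5 (seqSix a₀ a₁ a₂ a₃ a₄ a₅) := by
  have s01 := hb.not_mem_of_adj h01
  have s12 := hb.not_mem_of_adj h12
  have s23 := hb.not_mem_of_adj h23
  have s34 := hb.not_mem_of_adj h34
  have s45 := hb.not_mem_of_adj h45
  have n03 : a₀ ≠ a₃ := by rintro rfl; tauto
  have n05 : a₀ ≠ a₅ := by rintro rfl; tauto
  have n14 : a₁ ≠ a₄ := by rintro rfl; tauto
  have n25 : a₂ ≠ a₅ := by rintro rfl; tauto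
  constructor
  · intro i hi j hj h
    interval_cases i <;> interval_cases j <;>
      simp [seqSix, h01.ne, h12.ne, h23.ne, h34.ne, h45.ne, h01.ne', h12.ne', h23.ne', h34.ne',
        h45.ne', n02, n04, n24, n13, n15, n35, n03, n05, n14, n25, n02.symm, n04.symm, n24.symm,
        n13.symm, n15.symm, n35.symm, n03.symm, n05.symm, n14.symm, n25.symm] at h ⊢
  · intro i hi
    interval_cases i <;> simp [seqSix, *]

lemma exists_adj_ends_of_isMinClosed (hb : IsBipartition G X Y) (hc : BipCHom G X Y) {n : ℕ}
    (hn : IsMinClosed G (n + 1)) {c : ℕ → V} (hcn : IsPathSeq G (n + 1) c)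
    (hcl : G.Adj (c (n + 1)) (c 0)) {p : ℕ → V} (hp : IsPathSeq G n p) :
    ∃ w, G.Adj w (p 0) ∧ G.Adj w (p n) := by
  have hpi := hn.isInducedPathSeq hp n.lt_succ_self
  have h01 := hb.not_mem_of_adj (hcn.2 0 n.succ_pos)
  by_cases h0 : c 0 ∈ X ↔ p 0 ∈ X
  · obtain ⟨ψ, -, hψ⟩ := hc.exists_aut_path hb
      (hn.isInducedPathSeq (hcn.mono n.le_succ) n.lt_succ_self) hpi h0
    refine ⟨ψ (c (n + 1)), ?_, ?_⟩
    · rw [← hψ 0 n.zero_le]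
      exact ψ.map_adj_iff.2 hcl
    · rw [← hψ n le_rfl]
      exact ψ.map_adj_iff.2 (hcn.2 n n.lt_succ_self).symm
  · obtain ⟨ψ, -, hψ⟩ := hc.exists_aut_path hb
      (hn.isInducedPathSeq (IsPathSeq.shift 1 (hcn.mono (by omega))) n.lt_succ_self) hpi
      (by simp only [add_zero]; simp only [zero_add] at h01; tauto)
    refine ⟨ψ (c 0), ?_, ?_⟩
    · rw [← hψ 0 n.zero_le]
      exact ψ.map_adj_iff.2 (hcn.2 0 n.succ_pos)
    · rw [← hψ n le_rfl, add_comm]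
      exact ψ.map_adj_iff.2 hcl.symm

lemma BipCHom.exists_aut_vertex_of_iff (hb : IsBipartition G X Y) (hc : BipCHom G X Y) {v w : V}
    (h : v ∈ X ↔ w ∈ X) : ∃ ψ : G ≃g G, ψ v = w := by
  by_cases hv : v ∈ X
  · obtain ⟨ψ, -, hψ⟩ := hc.symm.exists_aut_vertex hb.symm hv (h.1 hv)
    exact ⟨ψ, hψ⟩
  · obtain ⟨ψ, -, hψ⟩ := hc.exists_aut_vertex hb (hb.mem_right_iff.2 hv)
      (hb.mem_right_iff.2 (mt h.2 hv))
    exact ⟨ψ, hψ⟩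

/-- If the shortest cycles are longer than four and some vertex has three neighbours, then the
shortest cycles have length six. -/
lemma eq_four_of_isMinClosed (hb : IsBipartition G X Y) (hc : BipCHom G X Y)
    (h4 : ¬ HasFourCycle G) {n : ℕ} (hn4 : 4 ≤ n) (hne : Even n)
    (hn : IsMinClosed G (n + 1)) {c : ℕ → V} (hcn : IsPathSeq G (n + 1) c)
    (hcl : G.Adj (c (n + 1)) (c 0)) {v : V} {U : Finset V} (hU : U.card = 3)
    (hUv : ∀ u ∈ U, G.Adj v u) : n = 4 := by
  classical
  obtain ⟨q, hq, hqv⟩ : ∃ q, IsPathSeq G (n - 1) q ∧ q (n - 1) = v := by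
    have h1 := hcn.mem_iff hb (i := n - 1) (by omega)
    have h2 := hcn.mem_iff hb (i := n) (by omega)
    have h3 : ¬ Even (n - 1) := by
      rw [Nat.even_sub (by omega)]
      simp [hne]
    by_cases h : c (n - 1) ∈ X ↔ v ∈ X
    · obtain ⟨ψ, hψ⟩ := hc.exists_aut_vertex_of_iff hb h
      exact ⟨ψ ∘ c, (hcn.mono (by omega)).map ψ, hψ⟩
    · obtain ⟨ψ, hψ⟩ := hc.exists_aut_vertex_of_iff hb (v := c n) (w := v) (by tauto)
      refine ⟨_, (IsPathSeq.shift 1 (hcn.mono (by omega))).map ψ, ?_⟩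
      rw [← hψ, Function.comp_apply, Nat.add_sub_cancel' (by omega)]
  have hqi := hn.isInducedPathSeq hq (by omega)
  obtain ⟨a, ha, b, hb', hab⟩ : ∃ a ∈ U.erase (q (n - 2)), ∃ b ∈ U.erase (q (n - 2)), a ≠ b := by
    rw [← Finset.one_lt_card]
    have := Finset.pred_card_le_card_erase (s := U) (a := q (n - 2))
    omega
  have hnew : ∀ a ∈ U.erase (q (n - 2)), ∀ i ≤ n - 1, a ≠ q i := by
    rintro a ha i hi rfl
    rw [Finset.mem_erase] at ha
    have h1 := hUv _ ha.2
    rw [← hqv, hqi.2 _ le_rfl _ hi] at h1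
    have : i = n - 2 := by omega
    exact ha.1 (this ▸ rfl)
  have hadj : ∀ a ∈ U.erase (q (n - 2)), G.Adj v a := fun a ha => hUv a (Finset.mem_of_mem_erase ha)
  have hw : ∀ a ∈ U.erase (q (n - 2)), ∃ w, G.Adj w (q 0) ∧ G.Adj w a := by
    intro a ha
    obtain ⟨w, h1, h2⟩ := exists_adj_ends_of_isMinClosed hb hc hn hcn hcl
      (p := Function.update q n a) (by
        constructor
        · intro i hi j hj hij
          by_cases h1 : i = n <;> by_cases h2 : j = n
          · omega
          · subst h1
            rw [Function.update_self, Function.update_of_ne h2] at hij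
            exact absurd hij (hnew a ha j (by omega))
          · subst h2
            rw [Function.update_self, Function.update_of_ne h1] at hij
            exact absurd hij.symm (hnew a ha i (by omega))
          · rw [Function.update_of_ne h1, Function.update_of_ne h2] at hij
            exact hq.1 i (by omega) j (by omega) hij
        · intro i hi
          rw [Function.update_of_ne hi.ne]
          by_cases h1 : i + 1 = n
          · rw [h1, Function.update_self, show i = n - 1 by omega, hqv]
            exact hadj a ha
          · rw [Function.update_of_ne h1]
            exact hq.2 i (by omega))
    rw [Function.update_of_ne (by omega)] at h1
    rw [Function.update_self] at h2
    exact ⟨w, h1, h2⟩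
  obtain ⟨w, hw0, hwa⟩ := hw a ha
  obtain ⟨z, hz0, hzb⟩ := hw b hb'
  have hv0 : ¬ G.Adj v (q 0) := by
    rw [← hqv, hqi.2 _ le_rfl _ (Nat.zero_le _)]
    omega
  have hwv : w ≠ v := by rintro rfl; exact hv0 hw0
  have hzv : z ≠ v := by rintro rfl; exact hv0 hz0
  have hwz : w ≠ z := by
    rintro rfl
    exact h4 ⟨w, a, v, b, hwv, hab, hwa, (hadj a ha).symm, hadj b hb', hzb.symm⟩
  have := hn 5 (seqSix (q 0) w a v b z) (by norm_num)
    (isPathSeq_six hb hw0.symm hwa (hadj a ha).symm (hadj b hb') hzb.symm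
      (hnew a ha 0 (Nat.zero_le _)).symm (hnew b hb' 0 (Nat.zero_le _)).symm hab hwv hwz hzv.symm)
    hz0
  omega

lemma isCompleteBip_of_isMinClosed (hconn : G.Connected) (hb : IsBipartition G X Y)
    (hc : BipCHom G X Y) (h4 : ¬ HasFourCycle G) {n : ℕ} (hn4 : 4 ≤ n) (hne : Even n)
    (hn : IsMinClosed G (n + 1)) {c : ℕ → V} (hcn : IsPathSeq G (n + 1) c)
    (hcl : G.Adj (c (n + 1)) (c 0)) {v : V} (hv : v ∈ Y) {U : Finset V} (hU : U.card = 3)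
    (hUv : ∀ u ∈ U, G.Adj v u) : IsCompleteBip G := by
  classical
  obtain rfl := eq_four_of_isMinClosed hb hc h4 hn4 hne hn hcn hcl hU hUv
  refine ⟨X, Y, hb, adj_of_commonNbrs_of_steiner (t := 0) hb hc ?_ ?_ ⟨v, hv, U, hU, hUv⟩⟩
  · refine commonNbrs_two_of_path hconn hb fun a₀ a₁ a₂ a₃ a₄ h₀ h01 h12 h23 h34 h03 h14 => ?_
    exact exists_adj_ends_of_isMinClosed hb hc hn hcn hcl
      (isInducedPathSeq_five hb h₀ h01 h12 h23 h34 h03 h14).isPathSeq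
  · intro y _ y' _ W hW hy hy'
    obtain ⟨a, b, hab, rfl⟩ := Finset.card_eq_two.1 hW
    obtain rfl : y = y' := by
      by_contra hne
      exact h4 ⟨y, a, y', b, hne, hab, hy a (by simp), (hy' a (by simp)).symm, hy' b (by simp),
        (hy b (by simp)).symm⟩
    exact fun _ => id

lemma nonempty_iso_cycleGraph (hconn : G.Connected) {k : ℕ} (hk2 : 2 ≤ k) (hk : IsMinClosed G k)
    {c : ℕ → V} (hck : IsPathSeq G k c) (hcl : G.Adj (c k) (c 0))
    (h3 : ∀ v, ∀ U : Finset V, (∀ u ∈ U, G.Adj v u) → U.card ≠ 3) :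
    Nonempty (G ≃g SimpleGraph.cycleGraph (k + 1)) := by
  classical
  have h3' : ∀ v a b w, a ≠ b → G.Adj v a → G.Adj v b → G.Adj v w → w = a ∨ w = b := by
    intro v a b w hab ha hb hw
    by_contra! h
    refine h3 v {a, b, w} (by simp [ha, hb, hw]) ?_
    rw [Finset.card_eq_three]
    exact ⟨a, b, w, hab, h.1.symm, h.2.symm, rfl⟩
  have hsurj : ∀ v, ∃ i ≤ k, c i = v := by
    refine hconn.forall_of_adj ⟨0, k.zero_le, rfl⟩ ?_
    rintro _ w ⟨i, hi, rfl⟩ hw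
    rcases Nat.eq_zero_or_pos i with rfl | hi0
    · rcases h3' _ (c 1) (c k) w (fun h => by have := hck.1 1 (by omega) k le_rfl h; omega)
        (hck.2 0 (by omega)) hcl.symm hw with rfl | rfl
      exacts [⟨1, by omega, rfl⟩, ⟨k, le_rfl, rfl⟩]
    · obtain ⟨i, rfl⟩ : ∃ j, i = j + 1 := ⟨i - 1, by omega⟩
      rcases hi.eq_or_lt with rfl | hi
      · rcases h3' _ (c i) (c 0) w (fun h => by have := hck.1 i (by omega) 0 (by omega) h; omega)
          (hck.2 i (by omega)).symm hcl hw with rfl | rfl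
        exacts [⟨i, by omega, rfl⟩, ⟨0, by omega, rfl⟩]
      · rcases h3' _ (c i) (c (i + 1 + 1)) w
          (fun h => by have := hck.1 i (by omega) (i + 1 + 1) (by omega) h; omega)
          (hck.2 i (by omega)).symm (hck.2 (i + 1) hi) hw with rfl | rfl
        exacts [⟨i, by omega, rfl⟩, ⟨i + 1 + 1, by omega, rfl⟩]
  have hadj : ∀ i ≤ k, ∀ j ≤ k, i < j → (G.Adj (c i) (c j) ↔ i + 1 = j ∨ i = 0 ∧ j = k) := by
    intro i hi j hj hij
    constructor
    · intro h
      by_contra! hcon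
      have := hk.le_sub hck (by omega) hj h
      omega
    · rintro (rfl | ⟨rfl, rfl⟩)
      exacts [hck.2 i hj, hcl.symm]
  have hbij : Function.Bijective (fun i : Fin (k + 1) => c i) := by
    constructor
    · intro i j h
      exact Fin.ext (hck.1 i (by omega) j (by omega) h)
    · intro v
      obtain ⟨i, hi, rfl⟩ := hsurj v
      exact ⟨⟨i, by omega⟩, rfl⟩
  refine ⟨SimpleGraph.Iso.symm ⟨Equiv.ofBijective _ hbij, ?_⟩⟩
  have hlt : ∀ i j : Fin (k + 1), i < j →
      (G.Adj (c i) (c j) ↔ (SimpleGraph.cycleGraph (k + 1)).Adj i j) := by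
    intro i j hij
    have hij' : (i : ℕ) < j := hij
    rw [hadj i (by omega) j (by omega) hij, SimpleGraph.cycleGraph_adj', Fin.coe_sub_iff_lt.2 hij,
      Fin.coe_sub_iff_le.2 hij.le]
    omega
  intro i j
  rcases lt_trichotomy i j with h | rfl | h
  · exact hlt i j h
  · simp
  · rw [G.adj_comm, (SimpleGraph.cycleGraph (k + 1)).adj_comm]
    exact hlt j i h

lemma exists_isMinClosed (hcyc : ¬ G.IsAcyclic) : ∃ k c, 2 ≤ k ∧ IsMinClosed G k ∧
    IsPathSeq G k c ∧ G.Adj (c k) (c 0) := by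
  classical
  have hex : ∃ k c, 2 ≤ k ∧ IsPathSeq G k c ∧ G.Adj (c k) (c 0) := by
    unfold SimpleGraph.IsAcyclic at hcyc
    push Not at hcyc
    obtain ⟨v, p, hp⟩ := hcyc
    have h3 := hp.three_le_length
    refine ⟨p.length - 1, p.getVert, by omega, ⟨fun i hi j hj h => ?_, fun i hi => ?_⟩, ?_⟩
    · exact hp.getVert_injOn' hi hj h
    · exact p.adj_getVert_succ (by omega)
    · have := p.adj_getVert_succ (i := p.length - 1) (by omega)
      rw [Nat.sub_add_cancel (by omega), p.getVert_length] at this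
      rwa [p.getVert_zero]
  obtain ⟨c, h1, h2, h3⟩ := Nat.find_spec hex
  exact ⟨Nat.find hex, c, h1, fun l p hl hp hp' => Nat.find_min' hex ⟨p, hl, hp, hp'⟩, h2, h3⟩

lemma classification_of_not_isAcyclic (hconn : G.Connected) (hb : IsBipartition G X Y)
    (hc : BipCHom G X Y) (hcyc : ¬ G.IsAcyclic) (h4 : ¬ HasFourCycle G) :
    IsEvenCycle G ∨ IsCompleteBip G := by
  obtain ⟨k, c, hk2, hk, hck, hcl⟩ := exists_isMinClosed hcyc
  have hkodd : ¬ Even k := by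
    have h1 := hck.mem_iff hb le_rfl
    have h2 := hb.not_mem_of_adj hcl
    tauto
  by_cases h3 : ∃ v, ∃ U : Finset V, U.card = 3 ∧ ∀ u ∈ U, G.Adj v u
  · right
    obtain ⟨v, U, hU, hUv⟩ := h3
    have hk3 : k ≠ 3 := by
      rintro rfl
      exact h4 ⟨c 0, c 1, c 2, c 3,
        fun h => by have := hck.1 0 (by omega) 2 (by omega) h; omega,
        fun h => by have := hck.1 1 (by omega) 3 (by omega) h; omega,
        hck.2 0 (by omega), hck.2 1 (by omega), hck.2 2 (by omega), hcl⟩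
    rw [Nat.not_even_iff_odd] at hkodd
    obtain ⟨m, rfl⟩ := hkodd
    rcases hb.mem_left_or_right v with hv | hv
    · exact isCompleteBip_of_isMinClosed hconn hb.symm hc.symm h4 (by omega) (even_two_mul m) hk hck
        hcl hv hU hUv
    · exact isCompleteBip_of_isMinClosed hconn hb hc h4 (by omega) (even_two_mul m) hk hck
        hcl hv hU hUv
  · left
    push Not at h3
    obtain ⟨e⟩ := nonempty_iso_cycleGraph hconn hk2 hk hck hcl fun v U hU hU3 => by
      obtain ⟨u, hu, h⟩ := h3 v U hU3
      exact h (hU u hu)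
    rw [Nat.not_even_iff_odd] at hkodd
    obtain ⟨m, rfl⟩ := hkodd
    exact ⟨m + 1, by omega, ⟨e⟩⟩

/-- A C-homogeneous bipartite tree is semi-regular. -/
lemma isSemiregularTree_of_isAcyclic (hconn : G.Connected) (hb : IsBipartition G X Y)
    (hc : BipCHom G X Y) (hcyc : G.IsAcyclic) : IsSemiregularTree G := by
  refine ⟨⟨hconn, hcyc⟩, X, Y, hb, fun a ha a' ha' => ?_, fun a ha a' ha' => ?_⟩
  · obtain ⟨ψ, rfl⟩ := hc.exists_aut_vertex_of_iff hb (iff_of_true ha ha')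
    exact ⟨ψ.mapNeighborSet a⟩
  · obtain ⟨ψ, rfl⟩ := hc.symm.exists_aut_vertex_of_iff hb.symm (iff_of_true ha ha')
    exact ⟨ψ.mapNeighborSet a⟩

/-- A finite partial bijection between equinumerous types extends to a bijection. -/
lemma exists_equiv_of_finite {ι : Type*} [Finite ι] {α β : Type u} (h : Nonempty (α ≃ β))
    (u : ι → α) (w : ι → β) (heq : ∀ i j, u i = u j ↔ w i = w j) :
    ∃ g : α ≃ β, ∀ i, g (u i) = w i := by
  have hs : ∀ z : range u, u (rangeSplitting u z) = z := apply_rangeSplitting u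
  obtain ⟨g, hg⟩ : ∃ g : α ≃ β, ∀ z : range u, g z = w (rangeSplitting u z) := by
    let f : range u ↪ β := ⟨fun z => w (rangeSplitting u z), fun z z' hz => by
      have := (heq _ _).2 hz
      rw [hs, hs] at this
      exact Subtype.ext this⟩
    rcases finite_or_infinite α with hα | hα
    · exact Cardinal.extend_function_finite f h
    · exact Cardinal.extend_function_of_lt f
        ((Cardinal.mk_lt_aleph0_iff.2 (finite_range u).to_subtype).trans_le
          (Cardinal.aleph0_le_mk α)) h
  exact ⟨g, fun i => (hg ⟨u i, mem_range_self i⟩).trans ((heq _ _).1 (hs _))⟩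

/-- Permutations of the two sides that are compatible with adjacency form an automorphism. -/
lemma IsBipartition.exists_aut_of_perm (hb : IsBipartition G X Y) (σ : Equiv.Perm X)
    (τ : Equiv.Perm Y) (hστ : ∀ x y, G.Adj (σ x).1 (τ y).1 ↔ G.Adj x.1 y.1) :
    ∃ ψ : G ≃g G, PreservesSides X Y ψ ∧ (∀ x : X, ψ x = σ x) ∧ ∀ y : Y, ψ y = τ y := by
  classical
  obtain rfl : Y = Xᶜ := by
    ext v
    exact hb.mem_right_iff
  let ψ : Equiv.Perm V := σ.subtypeCongr τ
  have h1 : ∀ x : X, ψ x = σ x := Equiv.Perm.subtypeCongr.left_apply_subtype σ τ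
  have h2 : ∀ y : (Xᶜ : Set V), ψ y = τ y := Equiv.Perm.subtypeCongr.right_apply_subtype σ τ
  have hX : ∀ v, v ∈ X ↔ ψ v ∈ X := by
    intro v
    by_cases hv : v ∈ X
    · exact iff_of_true hv (h1 ⟨v, hv⟩ ▸ (σ _).2)
    · exact iff_of_false hv (h2 ⟨v, hv⟩ ▸ (τ _).2)
  have hXY : ∀ x ∈ X, ∀ y ∉ X, G.Adj (ψ x) (ψ y) ↔ G.Adj x y := by
    intro x hx y hy
    have := hστ ⟨x, hx⟩ ⟨y, hy⟩
    rwa [← h1, ← h2] at this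
  refine ⟨⟨ψ, ?_⟩, ⟨hX, fun v => not_congr (hX v)⟩, h1, h2⟩
  intro a b
  by_cases ha : a ∈ X <;> by_cases hb' : b ∈ X
  · exact iff_of_false (hb.not_adj_left ((hX a).1 ha) ((hX b).1 hb')) (hb.not_adj_left ha hb')
  · exact hXY a ha b hb'
  · rw [G.adj_comm, G.adj_comm a]
    exact hXY b hb' a ha
  · exact iff_of_false (hb.not_adj_right (mt (hX a).2 ha) (mt (hX b).2 hb'))
      (hb.not_adj_right ha hb')

lemma BipHom.bipCHom (h : BipHom G X Y) : BipCHom G X Y :=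
  fun A B hA hB _ φ => h A B hA hB φ

lemma IsBipartition.bipHom_of_complete (hb : IsBipartition G X Y)
    (h : ∀ a ∈ X, ∀ b ∈ Y, G.Adj a b) : BipHom G X Y := by
  intro A B hA _ φ _ hX hY
  have := hA.to_subtype
  have hext : ∀ Z : Set V, (∀ a : A, a.1 ∈ Z ↔ (φ a).1 ∈ Z) →
      ∃ σ : Equiv.Perm Z, ∀ (a : A) (ha : a.1 ∈ Z), σ ⟨a, ha⟩ = (φ a).1 := by
    intro Z hZ
    obtain ⟨σ, hσ⟩ := exists_equiv_of_finite (ι := {a : A // a.1 ∈ Z}) ⟨Equiv.refl Z⟩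
      (fun a => ⟨a.1.1, a.2⟩) (fun a => ⟨(φ a.1).1, (hZ a.1).1 a.2⟩)
      (fun i j => by simp [Subtype.ext_iff, ← Subtype.ext_iff (a1 := φ _)])
    exact ⟨σ, fun a ha => congrArg Subtype.val (hσ ⟨a, ha⟩)⟩
  obtain ⟨σ, hσ⟩ := hext X hX
  obtain ⟨τ, hτ⟩ := hext Y hY
  obtain ⟨ψ, hψ, h1, h2⟩ := hb.exists_aut_of_perm σ τ fun x y =>
    iff_of_true (h _ (σ x).2 _ (τ y).2) (h _ x.2 _ y.2)
  refine ⟨ψ, hψ.1, hψ.2, fun a => ?_⟩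
  rcases hb.mem_left_or_right a.1 with ha | ha
  · exact (h1 ⟨a, ha⟩).trans (hσ a ha)
  · exact (h2 ⟨a, ha⟩).trans (hτ a ha)

lemma IsBipartition.bipHom_of_matching (hb : IsBipartition G X Y) (f : X ≃ Y)
    (hf : ∀ (a : X) (b : Y), G.Adj a.1 b.1 ↔ b.1 ≠ (f a).1) : BipHom G X Y := by
  classical
  intro A B hA _ φ hadj hX _
  have := hA.to_subtype
  let π : V → X := fun v => if h : v ∈ X then ⟨v, h⟩ else f.symm ⟨v, hb.mem_right_iff.2 h⟩
  have hπX : ∀ v (h : v ∈ X), π v = ⟨v, h⟩ := fun v h => dif_pos h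
  have hπY : ∀ v (h : v ∉ X), f (π v) = ⟨v, hb.mem_right_iff.2 h⟩ := fun v h => by
    simp only [π, dif_neg h, Equiv.apply_symm_apply]
  have hXX : ∀ v w, v ∈ X → w ∈ X → (π v = π w ↔ v = w) := by
    intro v w hv hw
    rw [hπX v hv, hπX w hw, Subtype.mk.injEq]
  have hYY : ∀ v w, v ∉ X → w ∉ X → (π v = π w ↔ v = w) := by
    intro v w hv hw
    rw [← f.injective.eq_iff, hπY v hv, hπY w hw, Subtype.mk.injEq]
  have hXY : ∀ v w, v ∈ X → w ∉ X → (π v = π w ↔ ¬ G.Adj v w) := by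
    intro v w hv hw
    rw [← f.injective.eq_iff, hπY w hw, hπX v hv, hf ⟨v, hv⟩ ⟨w, hb.mem_right_iff.2 hw⟩, not_not,
      Subtype.ext_iff, eq_comm]
  obtain ⟨σ, hσ⟩ := exists_equiv_of_finite ⟨Equiv.refl X⟩ (fun a : A => π a) (fun a => π (φ a)) (by
    intro a b
    have hφ : a.1 = b.1 ↔ (φ a).1 = (φ b).1 := by
      rw [← Subtype.ext_iff, ← Subtype.ext_iff, φ.injective.eq_iff]
    by_cases ha : a.1 ∈ X <;> by_cases hb' : b.1 ∈ X <;>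
      have ha' := ha <;> have hb'' := hb' <;> rw [hX] at ha' hb''
    · rw [hXX _ _ ha hb', hXX _ _ ha' hb'', hφ]
    · rw [hXY _ _ ha hb', hXY _ _ ha' hb'', hadj]
    · rw [eq_comm, hXY _ _ hb' ha, eq_comm, hXY _ _ hb'' ha', hadj]
    · rw [hYY _ _ ha hb', hYY _ _ ha' hb'', hφ])
  obtain ⟨ψ, hψ, h1, h2⟩ := hb.exists_aut_of_perm σ ((f.symm.trans σ).trans f) (by
    intro x y
    rw [hf, hf, Ne, Ne, ← Subtype.ext_iff, ← Subtype.ext_iff]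
    simp [Equiv.symm_apply_eq])
  refine ⟨ψ, hψ.1, hψ.2, fun a => ?_⟩
  by_cases ha : a.1 ∈ X
  · have h := hσ a
    rw [hπX _ ha, hπX _ ((hX a).1 ha)] at h
    rw [h1 ⟨a, ha⟩, h]
  · have h := congrArg f (hσ a)
    rw [hπY _ (mt (hX a).2 ha), ← f.symm_apply_eq.2 (hπY _ ha).symm] at h
    rw [h2 ⟨a, hb.mem_right_iff.2 ha⟩]
    exact congrArg Subtype.val h

lemma IsBipartition.preservesSides (hconn : G.Connected) (hb : IsBipartition G X Y) (ψ : G ≃g G)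
    {v : V} (hv : v ∈ X ↔ ψ v ∈ X) : PreservesSides X Y ψ := by
  have h : ∀ v, v ∈ X ↔ ψ v ∈ X := by
    refine hconn.forall_of_adj hv fun a b ha hab => ?_
    have h1 := hb.not_mem_of_adj hab
    have h2 := hb.not_mem_of_adj (ψ.map_adj_iff.2 hab)
    tauto
  exact ⟨h, fun v => by rw [hb.mem_right_iff, hb.mem_right_iff, h]⟩

lemma SimpleGraph.Connected.forall_mem_of_adj {A : Set V} (hA : (G.induce A).Connected)
    {p : V → Prop} {v : V} (hvA : v ∈ A) (hv : p v)
    (h : ∀ a ∈ A, ∀ b ∈ A, p a → G.Adj a b → p b) : ∀ w ∈ A, p w := fun w hw =>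
  hA.forall_of_adj (p := fun z => p z.1) (v := ⟨v, hvA⟩) hv
    (fun a b ha hab => h a a.2 b b.2 ha hab) ⟨w, hw⟩

/-- A connected bipartite graph of maximum degree two is C-homogeneous if its automorphism group
is transitive on arcs. -/
lemma IsBipartition.bipCHom_of_arcTransitive (hconn : G.Connected) (hb : IsBipartition G X Y)
    (hdeg : ∀ v, ∃ w, G.Adj v w)
    (h2 : ∀ v a b w, a ≠ b → G.Adj v a → G.Adj v b → G.Adj v w → w = a ∨ w = b)
    (harc : ∀ a a' b b', G.Adj a a' → G.Adj b b' → ∃ ψ : G ≃g G, ψ a = b ∧ ψ a' = b') :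
    BipCHom G X Y := by
  intro A B _ _ hA φ hadj hX _
  suffices h : ∃ ψ : G ≃g G, ∀ a : A, ψ a = φ a by
    obtain ⟨ψ, hψ⟩ := h
    obtain ⟨a⟩ := hA.nonempty
    obtain ⟨h1, h2⟩ := hb.preservesSides hconn ψ (v := a) (hψ a ▸ hX a)
    exact ⟨ψ, h1, h2, hψ⟩
  obtain ⟨a⟩ := hA.nonempty
  by_cases ha : ∃ a' : A, G.Adj a a'
  · obtain ⟨a', haa'⟩ := ha
    obtain ⟨ψ, h1, h1'⟩ := harc a a' (φ a) (φ a') haa' ((hadj _ _).1 haa')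
    have key := hA.forall_of_adj (v := a)
      (p := fun c => ψ c = φ c ∧ ∃ c' : A, G.Adj c c' ∧ ψ c' = φ c') ⟨h1, a', haa', h1'⟩ (by
        rintro c d ⟨hc, c', hcc', hc'⟩ hcd
        have hcd' : G.Adj c.1 d.1 := hcd
        refine ⟨?_, c, hcd'.symm, hc⟩
        by_cases hdc : d = c'
        · rw [hdc, hc']
        have hne : (φ c').1 ≠ φ d := fun h => hdc (φ.injective (Subtype.ext h)).symm
        refine (h2 (φ c) (φ c') (φ d) (ψ d) hne ((hadj _ _).1 hcc') ((hadj _ _).1 hcd')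
          (hc ▸ ψ.map_adj_iff.2 hcd')).resolve_left ?_
        rw [← hc', ψ.injective.eq_iff]
        exact fun h => hdc (Subtype.ext h))
    exact ⟨ψ, fun c => (key c).1⟩
  · push Not at ha
    have key := hA.forall_of_adj (v := a) (p := fun c => c = a) rfl (by
      rintro c d rfl hcd
      exact absurd hcd (ha d))
    obtain ⟨b, hab⟩ := hdeg a
    obtain ⟨b', hab'⟩ := hdeg (φ a)
    obtain ⟨ψ, h1, -⟩ := harc _ _ _ _ hab hab'
    exact ⟨ψ, fun c => by rw [key c, h1]⟩

lemma cycleGraph_exists_aut {n : ℕ} {a a' b b' : Fin (n + 2)}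
    (ha : (SimpleGraph.cycleGraph (n + 2)).Adj a a')
    (hb : (SimpleGraph.cycleGraph (n + 2)).Adj b b') :
    ∃ ψ : SimpleGraph.cycleGraph (n + 2) ≃g SimpleGraph.cycleGraph (n + 2),
      ψ a = b ∧ ψ a' = b' := by
  let τ (c : Fin (n + 2)) : SimpleGraph.cycleGraph (n + 2) ≃g SimpleGraph.cycleGraph (n + 2) :=
    ⟨Equiv.addRight c, by intro x y; simp [SimpleGraph.cycleGraph_adj]⟩
  let ρ (c : Fin (n + 2)) : SimpleGraph.cycleGraph (n + 2) ≃g SimpleGraph.cycleGraph (n + 2) :=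
    ⟨Equiv.subLeft c, by intro x y; simp [SimpleGraph.cycleGraph_adj, or_comm]⟩
  have hτ : ∀ c x, τ c x = x + c := fun _ _ => rfl
  have hρ : ∀ c x, ρ c x = c - x := fun _ _ => rfl
  rw [SimpleGraph.cycleGraph_adj] at ha hb
  by_cases h : a - a' = b - b'
  · refine ⟨τ (b - a), by rw [hτ]; abel, ?_⟩
    calc a' + (b - a) = b - (a - a') := by abel
      _ = b' := by rw [h]; abel
  · have h' : a' - a = b - b' := by
      have e1 : a' - a = -(a - a') := by abel
      have e2 : b' - b = -(b - b') := by abel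
      rw [e1] at ha ⊢
      rw [e2] at hb
      generalize a - a' = p at *
      generalize b - b' = q at *
      rcases ha with ha | ha <;> rcases hb with hb | hb
      · exact absurd (ha.trans hb.symm) h
      · rw [ha, ← hb, neg_neg]
      · rw [ha, hb]
      · exact absurd (neg_injective (ha.trans hb.symm)) h
    refine ⟨ρ (b + a), by rw [hρ]; abel, ?_⟩
    calc b + a - a' = b - (a' - a) := by abel
      _ = b' := by rw [h']; abel

lemma cycleGraph_eq_or_eq {n : ℕ} {v a b w : Fin (n + 2)} (hab : a ≠ b)
    (ha : (SimpleGraph.cycleGraph (n + 2)).Adj v a) (hb : (SimpleGraph.cycleGraph (n + 2)).Adj v b)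
    (hw : (SimpleGraph.cycleGraph (n + 2)).Adj v w) : w = a ∨ w = b := by
  have key : ∀ x, (SimpleGraph.cycleGraph (n + 2)).Adj v x → x = v - 1 ∨ x = v + 1 := by
    intro x hx
    rw [SimpleGraph.cycleGraph_adj, sub_eq_iff_eq_add', sub_eq_iff_eq_add'] at hx
    rcases hx with h | h
    · exact Or.inl (eq_sub_of_add_eq h.symm)
    · exact Or.inr h
  rcases key a ha with rfl | rfl <;> rcases key b hb with rfl | rfl <;>
    rcases key w hw with rfl | rfl <;> simp_all

lemma IsEvenCycle.exists_bipCHom (hconn : G.Connected) (h : IsEvenCycle G) :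
    ∃ X Y : Set V, IsBipartition G X Y ∧ BipCHom G X Y := by
  obtain ⟨k, ⟨e⟩⟩ : ∃ k, Nonempty (G ≃g SimpleGraph.cycleGraph (2 * k + 2)) := by
    obtain ⟨m, hm, he⟩ := h
    obtain ⟨k, rfl⟩ : ∃ k, m = k + 1 := ⟨m - 1, by omega⟩
    exact ⟨k, he⟩
  have hb : IsBipartition G {v | Even (e v).val} {v | ¬ Even (e v).val} := by
    refine ⟨by ext v; simp [Nat.even_or_odd], ?_, fun a b hab => ?_⟩
    · rw [Set.disjoint_left]
      exact fun v h h' => h' h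
    · rw [← e.map_adj_iff, SimpleGraph.cycleGraph_adj'] at hab
      have hpar : Even (e a).val ↔ ¬ Even (e b).val := by
        rcases le_total (e a) (e b) with h | h
        · rw [Fin.coe_sub_iff_le.2 h] at hab
          rcases h.eq_or_lt with h' | h'
          · simp [h'] at hab
          · rw [Fin.coe_sub_iff_lt.2 h'] at hab
            grind
        · rw [Fin.coe_sub_iff_le.2 h] at hab
          rcases h.eq_or_lt with h' | h'
          · simp [h'] at hab
          · rw [Fin.coe_sub_iff_lt.2 h'] at hab
            grind
      simp only [mem_ofPred_eq]
      tauto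
  refine ⟨_, _, hb, hb.bipCHom_of_arcTransitive hconn ?_ ?_ ?_⟩
  · intro v
    refine ⟨e.symm (e v + 1), ?_⟩
    rw [← e.map_adj_iff, e.apply_symm_apply, SimpleGraph.cycleGraph_adj]
    simp
  · intro v a b w hab ha hb hw
    rw [← e.map_adj_iff] at ha hb hw
    simpa using cycleGraph_eq_or_eq (e.injective.ne hab) ha hb hw
  · intro a a' b b' ha hb
    rw [← e.map_adj_iff] at ha hb
    obtain ⟨ψ, h1, h2⟩ := cycleGraph_exists_aut ha hb
    exact ⟨(e.trans ψ).trans e.symm, by simp [h1], by simp [h2]⟩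

/-- `par` and `d` assign to each vertex of a tree rooted at `r` its parent and its depth. -/
structure IsRooting (G : SimpleGraph V) (r : V) (par : V → V) (d : V → ℕ) : Prop where
  par_root : par r = r
  depth_root : d r = 0
  adj_par : ∀ v ≠ r, G.Adj v (par v)
  depth_par : ∀ v ≠ r, d v = d (par v) + 1
  par_eq : ∀ u v, G.Adj u v → (u ≠ r ∧ par u = v) ∨ (v ≠ r ∧ par v = u)

lemma SimpleGraph.IsTree.exists_isRooting (hG : G.IsTree) (r : V) :
    ∃ par d, IsRooting G r par d := by
  choose p hp hp' using fun v => hG.existsUnique_path v r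
  have hr : p r = .nil := (hp' r .nil (by simp)).symm
  have hnil : ∀ v ≠ r, ¬ (p v).Nil := fun v hv => SimpleGraph.Walk.not_nil_of_ne hv
  have htail : ∀ v ≠ r, (p v).tail = p (p v).snd := fun v hv => hp' _ _ (hp v).tail
  refine ⟨fun v => (p v).snd, fun v => (p v).length, by simp [hr], by simp [hr], ?_, ?_, ?_⟩
  · exact fun v hv => (p v).adj_snd (hnil v hv)
  · intro v hv
    rw [← SimpleGraph.Walk.length_tail_add_one (hnil v hv), htail v hv]
  · intro u v huv
    by_cases hv : v ∈ (p u).support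
    · refine Or.inl ⟨?_, (hG.isAcyclic.eq_snd_of_adj_start (hp u) huv hv).symm⟩
      rintro rfl
      rw [hr, SimpleGraph.Walk.mem_support_nil_iff] at hv
      exact huv.ne hv.symm
    · have h := hp' v (.cons huv.symm (p u)) ((hp u).cons hv)
      refine Or.inr ⟨?_, by rw [← h, SimpleGraph.Walk.snd_cons]⟩
      rintro rfl
      exact hv (p u).end_mem_support

lemma IsRooting.par_par_ne {r : V} {par : V → V} {d : V → ℕ} (h : IsRooting G r par d) {v : V}
    (hv : v ≠ r) : par (par v) ≠ v := by
  intro hpp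
  have h1 := h.depth_par v hv
  by_cases hr : par v = r
  · rw [hr, h.par_root] at hpp
    exact hv hpp.symm
  · have h2 := h.depth_par _ hr
    rw [hpp] at h2
    omega

/-- A connected vertex set containing the root is closed under taking parents. -/
lemma IsRooting.par_mem {r : V} {par : V → V} {d : V → ℕ} (h : IsRooting G r par d) {A : Set V}
    (hA : (G.induce A).Connected) (hr : r ∈ A) {v : V} (hv : v ∈ A) : par v ∈ A := by
  rcases eq_or_ne v r with rfl | hvr
  · rwa [h.par_root]
  by_contra hpar
  have key := hA.forall_mem_of_adj (v := v)
    (p := fun w => Relation.ReflTransGen (fun x y => x ≠ r ∧ par x = y) w v) hv .refl (by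
      intro a _ b hb ha hab
      rcases h.par_eq a b hab with ⟨har, rfl⟩ | h'
      · rcases ha.cases_head with rfl | ⟨c, ⟨-, rfl⟩, hc⟩
        · exact absurd hb hpar
        · exact hc
      · exact ha.head h') r hr
  rcases key.cases_head with h' | ⟨c, ⟨hc, -⟩, -⟩
  · exact hvr h'.symm
  · exact hc rfl

/-- A locally bijective map from a tree to itself is an automorphism. -/
lemma SimpleGraph.IsTree.exists_aut_of_bijOn (hG : G.IsTree) {f : V → V}
    (hf : ∀ v, BijOn f (G.neighborSet v) (G.neighborSet (f v))) :
    ∃ ψ : G ≃g G, ∀ v, ψ v = f v := by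
  obtain ⟨r⟩ := hG.connected.nonempty
  obtain ⟨par, d, h⟩ := hG.exists_isRooting r
  obtain ⟨par', d', h'⟩ := hG.exists_isRooting (f r)
  have hadj : ∀ u v, G.Adj u v → G.Adj (f u) (f v) := fun u v huv => (hf u).mapsTo huv
  have key : ∀ n, ∀ v ≠ r, d v = n → f v ≠ f r ∧ par' (f v) = f (par v) := by
    intro n
    induction n using Nat.strong_induction_on with
    | _ n ih =>
      rintro v hv rfl
      refine (h'.par_eq _ _ (hadj _ _ (h.adj_par v hv))).resolve_right ?_
      rintro ⟨h1, h2⟩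
      have hpr : par v ≠ r := fun h3 => h1 (congrArg f h3)
      have h3 := (ih _ (by rw [h.depth_par v hv]; omega) _ hpr rfl).2
      exact h.par_par_ne hv ((hf (par v)).injOn (h.adj_par _ hpr) (h.adj_par v hv).symm
        (h3.symm.trans h2))
  have hinj' : ∀ n, ∀ u v, d u = n → f u = f v → u = v := by
    intro n
    induction n using Nat.strong_induction_on with
    | _ n ih =>
      rintro u v rfl huv
      by_cases hu : u = r
      · by_contra hne
        exact (key _ v (fun hv => hne (hu.trans hv.symm)) rfl).1 (by rw [← huv, hu])
      by_cases hv : v = r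
      · exact absurd (by rw [huv, hv]) (key _ u hu rfl).1
      have hpar : par u = par v := by
        refine ih _ (by rw [h.depth_par u hu]; omega) _ _ rfl ?_
        rw [← (key _ u hu rfl).2, ← (key _ v hv rfl).2, huv]
      refine (hf (par u)).injOn (h.adj_par u hu).symm ?_ huv
      rw [hpar]
      exact (h.adj_par v hv).symm
  have hinj : Function.Injective f := fun u v => hinj' _ u v rfl
  have hsurj : Function.Surjective f := by
    refine hG.connected.forall_of_adj (p := fun w => ∃ v, f v = w) ⟨r, rfl⟩ ?_
    rintro _ b ⟨v, rfl⟩ hb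
    obtain ⟨w, -, hw⟩ := (hf v).surjOn hb
    exact ⟨w, hw⟩
  refine ⟨⟨Equiv.ofBijective f ⟨hinj, hsurj⟩, ?_⟩, fun v => rfl⟩
  intro u v
  refine ⟨fun huv => ?_, hadj u v⟩
  obtain ⟨w, hw, hwv⟩ := (hf u).surjOn huv
  rwa [hinj hwv] at hw

lemma exists_bijOn_neighborSet {ι : Type*} [Finite ι] {p q : V}
    (h : Nonempty (G.neighborSet p ≃ G.neighborSet q)) (u w : ι → V)
    (hu : ∀ i, u i ∈ G.neighborSet p) (hw : ∀ i, w i ∈ G.neighborSet q) (heq : ∀ i j, u i = u j ↔ w i = w j) :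
    ∃ g : V → V, BijOn g (G.neighborSet p) (G.neighborSet q) ∧ ∀ i, g (u i) = w i := by
  classical
  obtain ⟨e, he⟩ := exists_equiv_of_finite (ι := ι) h (fun i => ⟨u i, hu i⟩) (fun i => ⟨w i, hw i⟩)
    (fun i j => by rw [Subtype.mk_eq_mk, Subtype.mk_eq_mk, heq])
  let g : V → V := fun x => if hx : x ∈ G.neighborSet p then e ⟨x, hx⟩ else x
  have hg : ∀ x (hx : x ∈ G.neighborSet p), g x = e ⟨x, hx⟩ := fun x hx => dif_pos hx
  refine ⟨g, ⟨fun x hx => ?_, fun x hx y hy hxy => ?_, fun y hy => ?_⟩, fun i => ?_⟩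
  · rw [hg x hx]
    exact (e _).2
  · rw [hg x hx, hg y hy, ← Subtype.ext_iff, e.injective.eq_iff] at hxy
    exact congrArg Subtype.val hxy
  · refine ⟨e.symm ⟨y, hy⟩, (e.symm _).2, ?_⟩
    rw [hg _ (e.symm _).2]
    simp
  · rw [hg _ (hu i), he]

/-- A function on a rooted tree can be defined from its values at the two preceding vertices. -/
lemma IsRooting.exists_rec {r : V} {par : V → V} {d : V → ℕ} (h : IsRooting G r par d) {β : Type*}
    (b : β) (H : V → β → β → β) :
    ∃ f : V → β, f r = b ∧ ∀ v ≠ r, f v = H v (f (par v)) (f (par (par v))) := by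
  classical
  have h1 : ∀ v ≠ r, d (par v) < d v := fun v hv => by rw [h.depth_par v hv]; omega
  have h2 : ∀ v ≠ r, d (par (par v)) < d v := by
    intro v hv
    by_cases hp : par v = r
    · rw [hp, h.par_root, ← hp]
      exact h1 v hv
    · exact (h1 _ hp).trans (h1 v hv)
  let F : ∀ v, (∀ w, d w < d v → β) → β := fun v g =>
    if hv : v = r then b else H v (g (par v) (h1 v hv)) (g (par (par v)) (h2 v hv))
  refine ⟨(measure d).wf.fix F, ?_, fun v hv => ?_⟩
  · rw [WellFounded.fix_eq]
    exact dif_pos rfl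
  · rw [WellFounded.fix_eq]
    exact dif_neg hv

lemma IsBipartition.bipCHom_of_isTree (hG : G.IsTree) (hb : IsBipartition G X Y)
    (hX : ∀ a ∈ X, ∀ a' ∈ X, Nonempty (G.neighborSet a ≃ G.neighborSet a'))
    (hY : ∀ b ∈ Y, ∀ b' ∈ Y, Nonempty (G.neighborSet b ≃ G.neighborSet b')) :
    BipCHom G X Y := by
  classical
  intro A B hAf _ hA φ hφadj hφX _
  have := hAf.to_subtype
  obtain ⟨φ', hφ'⟩ : ∃ φ' : V → V, ∀ a : A, φ' a = φ a :=
    ⟨fun v => if h : v ∈ A then φ ⟨v, h⟩ else v, fun a => dif_pos a.2⟩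
  have hφX' : ∀ a ∈ A, a ∈ X ↔ φ' a ∈ X := fun a ha => hφ' ⟨a, ha⟩ ▸ hφX ⟨a, ha⟩
  have hφadj' : ∀ a ∈ A, ∀ b ∈ A, G.Adj a b → G.Adj (φ' a) (φ' b) := fun a ha b hb h => by
    rw [hφ' ⟨a, ha⟩, hφ' ⟨b, hb⟩]
    exact (hφadj ⟨a, ha⟩ ⟨b, hb⟩).1 h
  have hφinj' : ∀ a ∈ A, ∀ b ∈ A, φ' a = φ' b ↔ a = b := fun a ha b hb => by
    rw [hφ' ⟨a, ha⟩, hφ' ⟨b, hb⟩, ← Subtype.ext_iff, φ.injective.eq_iff, Subtype.mk.injEq]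
  have hsame : ∀ v w, (v ∈ X ↔ w ∈ X) → Nonempty (G.neighborSet v ≃ G.neighborSet w) := by
    intro v w h
    by_cases hv : v ∈ X
    · exact hX v hv w (h.1 hv)
    · exact hY v (hb.mem_right_iff.2 hv) w (hb.mem_right_iff.2 (mt h.2 hv))
  obtain ⟨⟨r, hr⟩⟩ := hA.nonempty
  obtain ⟨par, d, h⟩ := hG.exists_isRooting r
  let Good (p q t : V) (g : V → V) : Prop := BijOn g (G.neighborSet p) (G.neighborSet q) ∧
    (p ≠ r → g (par p) = t) ∧ (p ∈ A → ∀ a ∈ A, G.Adj p a → g a = φ' a)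
  let C (p q t : V) : V → V := if hg : ∃ g, Good p q t g then hg.choose else id
  have hC : ∀ p q t, (∃ g, Good p q t g) → Good p q t (C p q t) := fun p q t hg => by
    simp only [C, dif_pos hg]
    exact hg.choose_spec
  obtain ⟨f, hfr, hf⟩ := h.exists_rec (φ' r) (fun v q t => C (par v) q t v)
  have key : ∀ n v, d v = n → (v ∈ X ↔ f v ∈ X) ∧ (v ∈ A → f v = φ' v) ∧
      Good v (f v) (f (par v)) (C v (f v) (f (par v))) := by
    intro n
    induction n using Nat.strong_induction_on with
    | _ n ih =>
      rintro v rfl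
      have hcases : (v ∈ X ↔ f v ∈ X) ∧ (v ∈ A → f v = φ' v) ∧
          (v ≠ r → G.Adj (f v) (f (par v)) ∧ (par v ∈ A → f (par v) = φ' (par v))) := by
        rcases eq_or_ne v r with rfl | hv
        · rw [hfr]
          exact ⟨hφX' v hr, fun _ => rfl, fun h => absurd rfl h⟩
        · obtain ⟨h1, h2, h3, -, h5⟩ := ih (d (par v)) (by rw [h.depth_par v hv]; omega) _ rfl
          have hvp := h.adj_par v hv
          have hfv : G.Adj (f (par v)) (f v) := by
            rw [hf v hv]
            exact h3.mapsTo hvp.symm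
          refine ⟨?_, fun hvA => ?_, fun _ => ⟨hfv.symm, h2⟩⟩
          · have e1 := hb.not_mem_of_adj hvp
            have e2 := hb.not_mem_of_adj hfv
            tauto
          · rw [hf v hv]
            exact h5 (h.par_mem hA hr hvA) v hvA hvp.symm
      refine ⟨hcases.1, hcases.2.1, hC _ _ _ ?_⟩
      by_cases hvA : v ∈ A
      · obtain ⟨g, hg, hg'⟩ := exists_bijOn_neighborSet (ι := {a : A // G.Adj v a})
          (hsame v (f v) hcases.1) (fun a => a.1) (fun a => φ' a.1) (fun a => a.2)
          (fun a => hcases.2.1 hvA ▸ hφadj' v hvA _ a.1.2 a.2)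
          (fun a b => (hφinj' _ a.1.2 _ b.1.2).symm)
        refine ⟨g, hg, fun hv => ?_, fun _ a ha hva => hg' ⟨⟨a, ha⟩, hva⟩⟩
        have hpA := h.par_mem hA hr hvA
        rw [(hcases.2.2 hv).2 hpA]
        exact hg' ⟨⟨_, hpA⟩, h.adj_par v hv⟩
      · have hv : v ≠ r := fun hv => hvA (hv ▸ hr)
        obtain ⟨g, hg, hg'⟩ := exists_bijOn_neighborSet (ι := Unit)
          (hsame v (f v) hcases.1) (fun _ => par v) (fun _ => f (par v))
          (fun _ => h.adj_par v hv) (fun _ => (hcases.2.2 hv).1) (by simp)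
        exact ⟨g, hg, fun _ => hg' (), fun hvA' => absurd hvA' hvA⟩
  have hbij : ∀ v, BijOn f (G.neighborSet v) (G.neighborSet (f v)) := by
    intro v
    obtain ⟨-, -, h1, h2, -⟩ := key _ v rfl
    refine h1.congr fun u hu => ?_
    rcases h.par_eq v u hu with ⟨hv, rfl⟩ | ⟨hu', rfl⟩
    · exact h2 hv
    · exact (hf u hu').symm
  obtain ⟨ψ, hψ⟩ := hG.exists_aut_of_bijOn hbij
  have hψX : ∀ v, v ∈ X ↔ ψ v ∈ X := fun v => hψ v ▸ (key _ v rfl).1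
  refine ⟨ψ, hψX, fun v => ?_, fun a => ?_⟩
  · rw [hb.mem_right_iff, hb.mem_right_iff, hψX]
  · rw [hψ, (key _ a.1 rfl).2.1 a.2, hφ']

end

/-- Classification of the connected C-homogeneous bipartite graphs. -/
theorem stmt_15 {V : Type u} (G : SimpleGraph V) (hconn : G.Connected) :
    (∃ X Y : Set V, IsBipartition G X Y ∧ BipCHom G X Y) ↔
      (IsSemiregularTree G ∨ IsEvenCycle G ∨ IsCompleteBip G ∨ IsCPGraph G ∨
        IsHomGenericBip G) := by
  constructor
  · rintro ⟨X, Y, hb, hc⟩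
    by_cases hcyc : G.IsAcyclic
    · exact Or.inl (isSemiregularTree_of_isAcyclic hconn hb hc hcyc)
    by_cases h4 : HasFourCycle G
    · exact Or.inr (Or.inr (classification_of_hasFourCycle hconn hb hc h4))
    · rcases classification_of_not_isAcyclic hconn hb hc hcyc h4 with h | h
      exacts [Or.inr (Or.inl h), Or.inr (Or.inr (Or.inl h))]
  · rintro (⟨hG, X, Y, hb, hX, hY⟩ | h | ⟨X, Y, hb, h⟩ | ⟨X, Y, hb, f, hf⟩ | ⟨X, Y, hb, -, h⟩)
    · exact ⟨X, Y, hb, hb.bipCHom_of_isTree hG hX hY⟩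
    · exact h.exists_bipCHom hconn
    · exact ⟨X, Y, hb, (hb.bipHom_of_complete h).bipCHom⟩
    · exact ⟨X, Y, hb, (hb.bipHom_of_matching f hf).bipCHom⟩
    · exact ⟨X, Y, hb, h.bipCHom⟩
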